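/- Assume char k = 0, each q_i is a root of unity with multiplicative order n_i ≥ 2, the orders n₁, …, n_m are pairwise coprime, and each h_i ∉ k (each h_i is nonconstant). Then W is cancellative: for every associative unital k-algebra B, if the polynomial rings W[s] and B[s] are isomorphic as k-algebras, then W and B are isomorphic as k-algebras. -/

import Mathlib

/-- Generators of the degree `m` quantum generalized Weyl algebra:
`x i`, `y i` for `i : Fin m`, and `t`. -/
inductive GWAGen (m : ℕ) : Type
  | x : Fin m → GWAGen m
  | y : Fin m → GWAGen m
  | t : GWAGen m

/-- The defining relations of the degree `m` quantum generalized Weyl algebra over `k`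
with parameters `q : Fin m → k` and `h : Fin m → k[X]`:
`xᵢt = qᵢ·txᵢ`, `yᵢt = qᵢ⁻¹·tyᵢ`, `xᵢyᵢ = hᵢ(t)`, `yᵢxᵢ = hᵢ(qᵢ⁻¹t)`, and
`xᵢ`, `yᵢ` commute with `xⱼ`, `yⱼ` for `i ≠ j`. -/
inductive GWARel (k : Type*) [Field k] (m : ℕ) (q : Fin m → k) (h : Fin m → Polynomial k) :
    FreeAlgebra k (GWAGen m) → FreeAlgebra k (GWAGen m) → Prop
  | xt (i : Fin m) : GWARel k m q h
      (FreeAlgebra.ι k (GWAGen.x i) * FreeAlgebra.ι k GWAGen.t)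
      (q i • (FreeAlgebra.ι k GWAGen.t * FreeAlgebra.ι k (GWAGen.x i)))
  | yt (i : Fin m) : GWARel k m q h
      (FreeAlgebra.ι k (GWAGen.y i) * FreeAlgebra.ι k GWAGen.t)
      ((q i)⁻¹ • (FreeAlgebra.ι k GWAGen.t * FreeAlgebra.ι k (GWAGen.y i)))
  | xy (i : Fin m) : GWARel k m q h
      (FreeAlgebra.ι k (GWAGen.x i) * FreeAlgebra.ι k (GWAGen.y i))
      (Polynomial.aeval (FreeAlgebra.ι k GWAGen.t) (h i))
  | yx (i : Fin m) : GWARel k m q h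
      (FreeAlgebra.ι k (GWAGen.y i) * FreeAlgebra.ι k (GWAGen.x i))
      (Polynomial.aeval ((q i)⁻¹ • FreeAlgebra.ι k GWAGen.t) (h i))
  | xx (i j : Fin m) (hij : i ≠ j) : GWARel k m q h
      (FreeAlgebra.ι k (GWAGen.x i) * FreeAlgebra.ι k (GWAGen.x j))
      (FreeAlgebra.ι k (GWAGen.x j) * FreeAlgebra.ι k (GWAGen.x i))
  | yy (i j : Fin m) (hij : i ≠ j) : GWARel k m q h
      (FreeAlgebra.ι k (GWAGen.y i) * FreeAlgebra.ι k (GWAGen.y j))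
      (FreeAlgebra.ι k (GWAGen.y j) * FreeAlgebra.ι k (GWAGen.y i))
  | xyc (i j : Fin m) (hij : i ≠ j) : GWARel k m q h
      (FreeAlgebra.ι k (GWAGen.x i) * FreeAlgebra.ι k (GWAGen.y j))
      (FreeAlgebra.ι k (GWAGen.y j) * FreeAlgebra.ι k (GWAGen.x i))

/-- The degree `m` quantum generalized Weyl algebra `k[t](x, y, σ, h)` with `σᵢ(t) = qᵢt`:
the quotient of the free algebra on the generators by the two-sided ideal generated by
the defining relations. -/
abbrev GWA (k : Type*) [Field k] (m : ℕ) (q : Fin m → k) (h : Fin m → Polynomial k) : Type _ :=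
  RingQuot (GWARel k m q h)

variable {k : Type*} [Field k] {m : ℕ} {q : Fin m → k} {h : Fin m → Polynomial k}

/-- The generator `xᵢ` of the quantum GWA. -/
noncomputable def GWA.x (i : Fin m) : GWA k m q h :=
  RingQuot.mkAlgHom k (GWARel k m q h) (FreeAlgebra.ι k (GWAGen.x i))

/-- The generator `yᵢ` of the quantum GWA. -/
noncomputable def GWA.y (i : Fin m) : GWA k m q h :=
  RingQuot.mkAlgHom k (GWARel k m q h) (FreeAlgebra.ι k (GWAGen.y i))

/-- The generator `t` of the quantum GWA. -/
noncomputable def GWA.t : GWA k m q h :=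
  RingQuot.mkAlgHom k (GWARel k m q h) (FreeAlgebra.ι k GWAGen.t)

/-- The quantum GWA is an algebra over its center. -/
noncomputable instance GWA.algebraCenter :
    Algebra (Subalgebra.center k (GWA k m q h)) (GWA k m q h) :=
  RingHom.toAlgebra' (Subalgebra.center k (GWA k m q h)).val.toRingHom
    (fun c x => by
      have := Subalgebra.mem_center_iff.mp c.2 x
      simpa using this.symm)

section

open Polynomial

universe u v

/-- A locally nilpotent derivation of a ring, given as an additive map. -/
structure IsLND {R : Type*} [Ring R] (d : R →+ R) : Prop where
  leibniz : ∀ a b, d (a * b) = d a * b + a * d b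
  nil : ∀ a, ∃ n : ℕ, d^[n] a = 0

namespace IsLND

section Basic
variable {R : Type*} [Ring R] {d : R →+ R} (hd : IsLND d)
include hd

theorem apply_one : d 1 = 0 := by
  have := hd.leibniz 1 1
  simpa using this

theorem apply_natCast (n : ℕ) : d (n : R) = 0 := by
  induction n with
  | zero => simp
  | succ n ih => rw [Nat.cast_succ, map_add, ih, hd.apply_one, add_zero]

end Basic

theorem iterate_ne_zero_of_ne_zero {R : Type*} [Ring R] {d : R →+ R} (hd : IsLND d) {a : R}
    (ha : a ≠ 0) : ∃ r, d^[r] a ≠ 0 ∧ d^[r + 1] a = 0 := by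
  classical
  have h := hd.nil a
  have h1 := Nat.find_spec h
  obtain ⟨r, hr⟩ : ∃ r, Nat.find h = r + 1 := by
    refine Nat.exists_eq_succ_of_ne_zero fun h0 => ha ?_
    rw [h0] at h1
    exact h1
  refine ⟨r, Nat.find_min h (by omega), hr ▸ h1⟩

section Comm
variable {R : Type*} [CommRing R] {d : R →+ R} (hd : IsLND d)
include hd

theorem apply_pow (a : R) (n : ℕ) : d (a ^ n) = n * a ^ (n - 1) * d a := by
  induction n with
  | zero => simp [hd.apply_one]
  | succ n ih =>
    rw [pow_succ, hd.leibniz, ih]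
    rcases n with _ | n
    · simp
    · simp only [Nat.add_sub_cancel]
      push_cast
      ring

theorem iterate_mul_top (n r e : ℕ) (hn : n = r + e) (a b : R) (ha : d^[r + 1] a = 0)
    (hb : d^[e + 1] b = 0) :
    ∃ c : ℕ, 0 < c ∧ d^[n] (a * b) = c * (d^[r] a * d^[e] b) := by
  induction n generalizing r e a b with
  | zero =>
    obtain ⟨rfl, rfl⟩ : r = 0 ∧ e = 0 := by omega
    exact ⟨1, one_pos, by simp⟩
  | succ n ih =>
    rw [Function.iterate_succ_apply, hd.leibniz, iterate_map_add]
    rcases r with _ | r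
    · obtain rfl : e = n + 1 := by omega
      have ha' : d a = 0 := by simpa using ha
      rw [ha', zero_mul, iterate_map_zero, zero_add]
      obtain ⟨c, hc, h⟩ := ih 0 n (by simp) a (d b) ha hb
      exact ⟨c, hc, h⟩
    · rcases e with _ | e
      · obtain rfl : r = n := by omega
        have hb' : d b = 0 := by simpa using hb
        rw [hb', mul_zero, iterate_map_zero, add_zero]
        obtain ⟨c, hc, h⟩ := ih r 0 (by simp) (d a) b ha hb
        exact ⟨c, hc, h⟩
      · obtain ⟨c, hc, h⟩ := ih r (e + 1) (by omega) (d a) b ha hb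
        obtain ⟨c', hc', h'⟩ := ih (r + 1) e (by omega) a (d b) ha hb
        refine ⟨c + c', by omega, ?_⟩
        rw [h, h', ← Function.iterate_succ_apply, ← Function.iterate_succ_apply]
        push_cast
        ring

theorem eq_zero_of_mul [IsDomain R] [CharZero R] {a b : R} (hab : a * b ≠ 0) (h : d (a * b) = 0) :
    d a = 0 := by
  obtain ⟨r, hr, hr'⟩ := hd.iterate_ne_zero_of_ne_zero (left_ne_zero_of_mul hab)
  obtain ⟨e, he, he'⟩ := hd.iterate_ne_zero_of_ne_zero (right_ne_zero_of_mul hab)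
  obtain ⟨c, hc, hce⟩ := hd.iterate_mul_top _ r e rfl a b hr' he'
  rcases r with _ | r
  · simpa using hr'
  · exfalso
    rw [show r + 1 + e = (r + e) + 1 by omega, Function.iterate_succ_apply, h,
      iterate_map_zero] at hce
    exact mul_ne_zero (Nat.cast_ne_zero.2 hc.ne') (mul_ne_zero hr he) hce.symm

theorem map_eval (P : Polynomial R) (hP : ∀ i, d (P.coeff i) = 0) (a : R) :
    d (P.eval a) = P.derivative.eval a * d a := by
  rw [Polynomial.eval_eq_sum_range, Polynomial.derivative_eval,
    Polynomial.sum_over_range _ (by simp),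
    map_sum, Finset.sum_mul]
  refine Finset.sum_congr rfl fun i _ => ?_
  rw [hd.leibniz, hP, hd.apply_pow]
  ring

theorem eq_zero_of_isRoot [IsDomain R] [CharZero R] {P : Polynomial R} (hP0 : P ≠ 0)
    (hP : ∀ i, d (P.coeff i) = 0) {a : R} (h : P.eval a = 0) : d a = 0 := by
  induction hn : P.natDegree using Nat.strong_induction_on generalizing P with
  | _ n ih =>
  have h1 := hd.map_eval P hP a
  rw [h, map_zero, eq_comm, mul_eq_zero] at h1
  refine h1.elim (fun h1 => ?_) id
  have hdeg : P.natDegree ≠ 0 := fun h0 => by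
    rw [Polynomial.eq_C_of_natDegree_eq_zero h0, Polynomial.eval_C] at h
    rw [Polynomial.eq_C_of_natDegree_eq_zero h0, h] at hP0
    simp at hP0
  refine ih P.derivative.natDegree (hn ▸ Polynomial.natDegree_derivative_lt hdeg) ?_ ?_ h1 rfl
  · intro h0
    exact hdeg (Polynomial.derivative_eq_zero.1 h0)
  · intro i
    rw [Polynomial.coeff_derivative, hd.leibniz, hP, zero_mul, zero_add,
      show ((i : R) + 1) = ((i + 1 : ℕ) : R) by push_cast; rfl, hd.apply_natCast, mul_zero]

theorem eq_zero_of_mem_radical [IsDomain R] [CharZero R] {a : R}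
    (h : ∀ j, 1 ≤ j → d^[j] a ∈ (Ideal.span {a}).radical) : d a = 0 := by
  by_cases ha : a = 0
  · simp [ha]
  obtain ⟨r, hr, hr'⟩ := hd.iterate_ne_zero_of_ne_zero ha
  rcases r with _ | r
  · simpa using hr'
  obtain ⟨K, hK⟩ := h (r + 1) (by omega)
  obtain ⟨b, hb⟩ := Ideal.mem_span_singleton'.1 hK
  have hc : d (d^[r + 1] a) = 0 := by
    rw [← Function.iterate_succ_apply' d]; exact hr'
  refine hd.eq_zero_of_mul (b := b) ?_ ?_
  · rw [mul_comm, hb]; exact pow_ne_zero _ hr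
  · rw [mul_comm, hb, hd.apply_pow, hc, mul_zero]

theorem map_mem_of_mul_pow_eq_zero {P : Ideal R} [hP : P.IsPrime]
    (hchar : ∀ n : ℕ, n ≠ 0 → (n : R) ∉ P)
    {a : R} (j : ℕ) : ∀ (l : ℕ) (g : R), g ∉ P → g * a ^ j * d a ^ l = 0 → d a ∈ P := by
  induction j with
  | zero =>
    intro l g hg h
    have : g * d a ^ l ∈ P := by
      simp only [pow_zero, mul_one] at h
      rw [h]; exact P.zero_mem
    exact hP.mem_of_pow_mem _ ((hP.mem_or_mem this).resolve_left hg)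
  | succ j ih =>
    intro l g hg h
    refine ih (l + 2) ((j + 1 : ℕ) * g ^ 2) ?_ ?_
    · intro hmem
      rcases hP.mem_or_mem hmem with h' | h'
      · exact hchar _ (by omega) h'
      · exact hg (hP.mem_of_pow_mem _ h')
    · have h1 : d (g * a ^ (j + 1) * d a ^ l) = 0 := by rw [h, map_zero]
      rw [hd.leibniz, hd.leibniz, hd.apply_pow, hd.apply_pow] at h1
      have h2 : ((j + 1 : ℕ) * g ^ 2) * a ^ j * d a ^ (l + 2)
          = (g * d a) * ((d g * a ^ (j + 1) + g * ((j + 1 : ℕ) * a ^ (j + 1 - 1) * d a)) * d a ^ l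
            + g * a ^ (j + 1) * (l * d a ^ (l - 1) * d (d a)))
            - d g * d a * (g * a ^ (j + 1) * d a ^ l)
            - l * g * d (d a) * (g * a ^ (j + 1) * d a ^ l) := by
        rcases l with _ | l
        · simp; ring
        · simp only [Nat.add_sub_cancel]
          ring
      rw [h2, h1, h]
      ring

/-- The derivation induced on the quotient by a stable ideal. -/
theorem exists_quotient {P : Ideal R} (hP : ∀ a ∈ P, d a ∈ P) :
    ∃ d' : R ⧸ P →+ R ⧸ P, IsLND d' ∧ ∀ a,
      d' (Ideal.Quotient.mk P a) = Ideal.Quotient.mk P (d a) := by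
  let d' : R ⧸ P →+ R ⧸ P := QuotientAddGroup.map P.toAddSubgroup P.toAddSubgroup d hP
  have hd' : ∀ a, d' (Ideal.Quotient.mk P a) = Ideal.Quotient.mk P (d a) := fun a => rfl
  have hit : ∀ n a, d'^[n] (Ideal.Quotient.mk P a) = Ideal.Quotient.mk P (d^[n] a) := by
    intro n
    induction n with
    | zero => intro a; rfl
    | succ n ih => intro a; rw [Function.iterate_succ_apply, hd', ih, Function.iterate_succ_apply]
  refine ⟨d', ⟨?_, ?_⟩, hd'⟩
  · intro a b
    obtain ⟨a, rfl⟩ := Ideal.Quotient.mk_surjective a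
    obtain ⟨b, rfl⟩ := Ideal.Quotient.mk_surjective b
    rw [← map_mul, hd', hd.leibniz]
    simp [hd']
  · intro a
    obtain ⟨a, rfl⟩ := Ideal.Quotient.mk_surjective a
    obtain ⟨n, hn⟩ := hd.nil a
    exact ⟨n, by rw [hit, hn, map_zero]⟩

end Comm
end IsLND

namespace IsLND

section ModPrime
variable {k Z : Type*} [Field k] [CharZero k] [CommRing Z] [Algebra k Z]

theorem natCast_notMem_of_ne_top (k : Type*) [Field k] [CharZero k] {R : Type*} [CommRing R]
    [Algebra k R] {P : Ideal R} (hP : P ≠ ⊤) (n : ℕ) (hn : n ≠ 0) : (n : R) ∉ P := fun h => by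
  refine hP ((Ideal.eq_top_iff_one P).2 ?_)
  have : (1 : R) = algebraMap k R ((n : k)⁻¹) * n := by
    rw [← map_natCast (algebraMap k R), ← map_mul, inv_mul_cancel₀ (Nat.cast_ne_zero.2 hn), map_one]
  rw [this]
  exact P.mul_mem_left _ h

theorem charZero_quotient (k : Type*) [Field k] [CharZero k] {R : Type*} [CommRing R]
    [Algebra k R] (P : Ideal R) [hP : P.IsPrime] : CharZero (R ⧸ P) := by
  have : Nontrivial (R ⧸ P) := Ideal.Quotient.nontrivial_iff.2 hP.ne_top
  exact charZero_of_injective_algebraMap (algebraMap k (R ⧸ P)).injective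

theorem exists_mul_pow_eq_zero_of_mem_minimalPrimes {R : Type*} [CommRing R] {p : Ideal R}
    (hp : p ∈ minimalPrimes R) {a : R} (ha : a ∈ p) : ∃ g ∉ p, ∃ n : ℕ, g * a ^ n = 0 := by
  have hpp : p.IsPrime := Ideal.IsMinimalPrime.isPrime hp
  by_contra! hcon
  obtain ⟨p', hp', -, hdis⟩ := Ideal.exists_le_prime_disjoint (⊥ : Ideal R)
    (p.primeCompl ⊔ Submonoid.powers a) (by
      rw [Set.disjoint_left]
      rintro x hx hxS
      obtain ⟨g, hg, _, ⟨n, rfl⟩, rfl⟩ := Submonoid.mem_sup.1 hxS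
      exact hcon g hg n hx)
  rw [Set.disjoint_left] at hdis
  have hle : p' ≤ p := fun x hx => by
    by_contra hxp
    exact hdis hx (Submonoid.mem_sup_left (show x ∈ p.primeCompl from hxp))
  exact hdis (hp.2 ⟨hp', bot_le⟩ hle ha) (Submonoid.mem_sup_right (Submonoid.mem_powers a))

theorem map_mem_map_C_of_minimalPrimes (k : Type*) [Field k] [CharZero k] {Z : Type*} [CommRing Z]
    [Algebra k Z] {d : Z[X] →+ Z[X]} (hd : IsLND d) {p : Ideal Z}
    (hp : p ∈ minimalPrimes Z) : ∀ a ∈ Ideal.map (C : Z →+* Z[X]) p, d a ∈ Ideal.map C p := by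
  have hpp : p.IsPrime := Ideal.IsMinimalPrime.isPrime hp
  have hP : (Ideal.map (C : Z →+* Z[X]) p).IsPrime := Ideal.isPrime_map_C_of_isPrime
  intro a ha
  refine Submodule.span_induction ?_ ?_ ?_ ?_ ha
  · rintro _ ⟨a, ha, rfl⟩
    obtain ⟨g, hg, n, hn⟩ := exists_mul_pow_eq_zero_of_mem_minimalPrimes hp ha
    refine hd.map_mem_of_mul_pow_eq_zero (P := Ideal.map C p)
      (natCast_notMem_of_ne_top k hP.ne_top) n 0 (C g) ?_ ?_
    · intro h
      have := Ideal.mem_map_C_iff.1 h 0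
      rw [coeff_C_zero] at this
      exact hg this
    · rw [pow_zero, mul_one, ← C_pow, ← C_mul, hn, C_0]
  · simp
  · intro x y _ _ hx hy
    rw [map_add]; exact Ideal.add_mem _ hx hy
  · intro b x hx' hx
    rw [smul_eq_mul, hd.leibniz]
    exact Ideal.add_mem _ (Ideal.mul_mem_left _ _ hx') (Ideal.mul_mem_left _ _ hx)

/-- The constants whose derivative vanishes modulo an ideal. -/
def constants {d : Z[X] →+ Z[X]} (hd : IsLND d) (hk : ∀ c : k, d (algebraMap k Z[X] c) = 0)
    (p : Ideal Z) : Subalgebra k Z where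
  carrier := {z | d (C z) ∈ Ideal.map (C : Z →+* Z[X]) p}
  mul_mem' := by
    intro a b ha hb
    rw [Set.mem_ofPred_eq] at *
    rw [C_mul, hd.leibniz]
    exact Ideal.add_mem _ (Ideal.mul_mem_right _ _ ha) (Ideal.mul_mem_left _ _ hb)
  add_mem' := by
    intro a b ha hb
    rw [Set.mem_ofPred_eq] at *
    rw [C_add, map_add]
    exact Ideal.add_mem _ ha hb
  algebraMap_mem' := by
    intro c
    rw [Set.mem_ofPred_eq, show C (algebraMap k Z c) = algebraMap k Z[X] c from rfl, hk]
    exact Ideal.zero_mem _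

variable {d : Z[X] →+ Z[X]} (hd : IsLND d) (hk : ∀ c : k, d (algebraMap k Z[X] c) = 0) {p : Ideal Z}

omit [CharZero k] in
theorem mem_constants {z : Z} :
    z ∈ hd.constants hk p ↔ d (C z) ∈ Ideal.map (C : Z →+* Z[X]) p := Iff.rfl

theorem mem_constants_of_isIntegral (hp : p ∈ minimalPrimes Z) {z : Z}
    (hz : IsIntegral (hd.constants hk p) z) : z ∈ hd.constants hk p := by
  have hpp : p.IsPrime := Ideal.IsMinimalPrime.isPrime hp
  have hP : (Ideal.map (C : Z →+* Z[X]) p).IsPrime := Ideal.isPrime_map_C_of_isPrime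
  obtain ⟨d', hd', hdd'⟩ := hd.exists_quotient (map_mem_map_C_of_minimalPrimes k hd hp)
  have : CharZero (Z[X] ⧸ Ideal.map (C : Z →+* Z[X]) p) := charZero_quotient k _
  obtain ⟨Q, hQ, hQz⟩ := hz
  let φ : Z →+* Z[X] ⧸ Ideal.map (C : Z →+* Z[X]) p := (Ideal.Quotient.mk _).comp C
  have key : d' (φ z) = 0 := by
    refine hd'.eq_zero_of_isRoot (P := Q.map (φ.comp (algebraMap (hd.constants hk p) Z))) ?_ ?_ ?_
    · exact (hQ.map _).ne_zero
    · intro i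
      rw [coeff_map]
      change d' (Ideal.Quotient.mk _ (C ((Q.coeff i : hd.constants hk p) : Z))) = 0
      rw [hdd']
      exact Ideal.Quotient.eq_zero_iff_mem.2 (Q.coeff i).2
    · rw [eval_map, ← hom_eval₂, hQz, map_zero]
  change d' (Ideal.Quotient.mk _ (C z)) = 0 at key
  rw [hdd'] at key
  exact Ideal.Quotient.eq_zero_iff_mem.1 key

theorem mem_constants_of_mul (hp : p ∈ minimalPrimes Z) {a b : Z} (hab : a * b ∉ p)
    (h : a * b ∈ hd.constants hk p) : a ∈ hd.constants hk p := by
  have hpp : p.IsPrime := Ideal.IsMinimalPrime.isPrime hp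
  have hP : (Ideal.map (C : Z →+* Z[X]) p).IsPrime := Ideal.isPrime_map_C_of_isPrime
  obtain ⟨d', hd', hdd'⟩ := hd.exists_quotient (map_mem_map_C_of_minimalPrimes k hd hp)
  have : CharZero (Z[X] ⧸ Ideal.map (C : Z →+* Z[X]) p) := charZero_quotient k _
  rw [mem_constants] at *
  rw [← Ideal.Quotient.eq_zero_iff_mem, ← hdd'] at h ⊢
  refine hd'.eq_zero_of_mul (b := Ideal.Quotient.mk _ (C b)) ?_ ?_
  · rw [← map_mul, ← C_mul]
    intro h0
    have := Ideal.mem_map_C_iff.1 (Ideal.Quotient.eq_zero_iff_mem.1 h0) 0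
    rw [coeff_C_zero] at this
    exact hab this
  · rw [← map_mul, ← C_mul]; exact h

theorem mem_constants_of_coeff_mem_radical (hp : p ∈ minimalPrimes Z) {a : Z}
    (h : ∀ j, 1 ≤ j → ∀ i, (d^[j] (C a)).coeff i ∈ (Ideal.span {a} ⊔ p).radical) :
    a ∈ hd.constants hk p := by
  have hpp : p.IsPrime := Ideal.IsMinimalPrime.isPrime hp
  have hP : (Ideal.map (C : Z →+* Z[X]) p).IsPrime := Ideal.isPrime_map_C_of_isPrime
  obtain ⟨d', hd', hdd'⟩ := hd.exists_quotient (map_mem_map_C_of_minimalPrimes k hd hp)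
  have : CharZero (Z[X] ⧸ Ideal.map (C : Z →+* Z[X]) p) := charZero_quotient k _
  rw [mem_constants, ← Ideal.Quotient.eq_zero_iff_mem, ← hdd']
  have hit : ∀ n a, d'^[n] (Ideal.Quotient.mk _ a) = Ideal.Quotient.mk _ (d^[n] a) := by
    intro n
    induction n with
    | zero => intro a; rfl
    | succ n ih => intro a; rw [Function.iterate_succ_apply, hdd', ih, Function.iterate_succ_apply]
  refine hd'.eq_zero_of_mem_radical fun j hj => ?_
  rw [hit]
  have h1 : d^[j] (C a) ∈ (Ideal.map (C : Z →+* Z[X]) (Ideal.span {a} ⊔ p)).radical :=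
    Ideal.map_radical_le _ (Ideal.mem_map_C_iff.2 (h j hj))
  obtain ⟨n, hn⟩ := h1
  refine ⟨n, ?_⟩
  rw [← map_pow]
  have h2 := Ideal.mem_map_of_mem (Ideal.Quotient.mk (Ideal.map (C : Z →+* Z[X]) p)) hn
  rw [Ideal.map_sup, Ideal.map_sup, Ideal.map_quotient_self, sup_bot_eq, Ideal.map_span,
    Ideal.map_span] at h2
  simpa using h2

theorem coeff_of_constants_eq_top (hp : p ∈ minimalPrimes Z) (htop : ∀ z, z ∈ hd.constants hk p)
    {f : Z[X]} (hf : d f = 1) :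
    (∃ v, f.coeff 1 * v - 1 ∈ p) ∧ ∀ j, 2 ≤ j → f.coeff j ∈ p := by
  have hpp : p.IsPrime := Ideal.IsMinimalPrime.isPrime hp
  have hdf : d f - derivative f * d X ∈ Ideal.map (C : Z →+* Z[X]) p := by
    clear hf
    induction f using Polynomial.induction_on' with
    | add f g hf hg =>
      rw [map_add, map_add, add_mul, add_sub_add_comm]
      exact Ideal.add_mem _ hf hg
    | monomial n a =>
      rw [← C_mul_X_pow_eq_monomial, hd.leibniz, hd.apply_pow, derivative_C_mul_X_pow]
      have : d (C a) * X ^ n + C a * ((n : Z[X]) * X ^ (n - 1) * d X) - C (a * ↑n) * X ^ (n - 1) *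
        d X
        = X ^ n * d (C a) := by
        simp; ring
      rw [this]
      exact Ideal.mul_mem_left _ _ (htop a)
  rw [hf] at hdf
  let π := Ideal.Quotient.mk p
  have h1 : (derivative (f.map π)) * (d X).map π = 1 := by
    have h2 : mapRingHom π (1 - derivative f * d X) = 0 := by
      rw [← RingHom.mem_ker, Polynomial.ker_mapRingHom, Ideal.mk_ker]; exact hdf
    rw [map_sub, map_mul, map_one, sub_eq_zero] at h2
    rw [derivative_map]
    exact h2.symm
  have h2 : IsUnit (derivative (f.map π)) := IsUnit.of_mul_eq_one _ h1
  obtain ⟨r, hr, hr'⟩ := Polynomial.isUnit_iff.1 h2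
  have hc : CharZero (Z ⧸ p) := charZero_quotient k p
  have hcoef : ∀ n, π (f.coeff (n + 1)) * (n + 1) = (C r).coeff n := fun n => by
    rw [hr', coeff_derivative, coeff_map]
  refine ⟨?_, ?_⟩
  · obtain ⟨v, hv⟩ := hr.exists_right_inv
    obtain ⟨v, rfl⟩ := Ideal.Quotient.mk_surjective v
    refine ⟨v, Ideal.Quotient.eq_zero_iff_mem.1 ?_⟩
    have := hcoef 0
    simp at this
    rw [map_sub, map_mul, map_one, sub_eq_zero, ← hv, ← this]
  · intro j hj
    obtain ⟨j, rfl⟩ : ∃ i, j = i + 1 + 1 := ⟨j - 2, by omega⟩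
    have := hcoef (j + 1)
    rw [coeff_C_succ, mul_eq_zero] at this
    refine Ideal.Quotient.eq_zero_iff_mem.1 (this.resolve_right ?_)
    exact_mod_cast Nat.succ_ne_zero (j + 1)

end ModPrime
end IsLND

section Newton
variable {Z : Type*} [CommRing Z]

theorem isUnit_and_isNilpotent_of_forall_minimalPrimes {f : Z[X]}
    (h : ∀ p ∈ minimalPrimes Z, (∃ v, f.coeff 1 * v - 1 ∈ p) ∧ ∀ j, 2 ≤ j → f.coeff j ∈ p) :
    IsUnit (f.coeff 1) ∧ ∀ j, 2 ≤ j → IsNilpotent (f.coeff j) := by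
  constructor
  · by_contra hu
    obtain ⟨M, hM, hfM⟩ := exists_max_ideal_of_mem_nonunits hu
    obtain ⟨p, hp, hpM⟩ := Ideal.exists_minimalPrimes_le (bot_le : (⊥ : Ideal Z) ≤ M)
    obtain ⟨v, hv⟩ := (h p hp).1
    refine hM.ne_top ((Ideal.eq_top_iff_one M).2 ?_)
    have := M.sub_mem (M.mul_mem_right v hfM) (hpM hv)
    simpa using this
  · intro j hj
    rw [← mem_nilradical, nilradical, Ideal.radical_eq_sInf, Ideal.mem_sInf]
    rintro I ⟨-, hI⟩
    obtain ⟨p, hp, hpM⟩ := Ideal.exists_minimalPrimes_le (bot_le : (⊥ : Ideal Z) ≤ I)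
    exact hpM ((h p hp).2 j hj)

theorem exists_eq_X_sub_C_mul_of_isNilpotent {f : Z[X]} (h1 : IsUnit (f.coeff 1))
    (h2 : ∀ j, 2 ≤ j → IsNilpotent (f.coeff j)) :
    ∃ (r : Z) (g : Z[X]), IsUnit g ∧ f = (X - C r) * g := by
  obtain ⟨v, hv⟩ := h1.exists_right_inv
  let g := divX (divX f)
  have hfg : f = (g * X + C (f.coeff 1)) * X + C (f.coeff 0) := by
    conv_lhs => rw [← divX_mul_X_add f, ← divX_mul_X_add (divX f)]
    simp [g]
  have hg : IsNilpotent g := by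
    rw [Polynomial.isNilpotent_iff]
    intro i
    simp only [g, coeff_divX]
    exact h2 _ (by omega)
  have hg' : IsNilpotent (derivative g) := by
    rw [Polynomial.isNilpotent_iff] at hg ⊢
    intro i
    rw [coeff_derivative]
    exact (Commute.all _ _).isNilpotent_mul_right (hg _)
  have nil_aeval : ∀ {p : Z[X]} (x : Z), IsNilpotent p → IsNilpotent (aeval x p) :=
    fun x hp => hp.map _
  let x := -(f.coeff 0 * v)
  have e1 : IsNilpotent (aeval x f) := by
    have : aeval x f = aeval x g * x ^ 2 := by
      conv_lhs => rw [hfg]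
      simp only [map_add, map_mul, aeval_X, aeval_C, Algebra.algebraMap_self, RingHom.id_apply]
      simp only [x]
      linear_combination (-(f.coeff 0)) * hv
    rw [this]
    exact (Commute.all _ _).isNilpotent_mul_right (nil_aeval x hg)
  have e2 : IsUnit (aeval x (derivative f)) := by
    have : aeval x (derivative f) = f.coeff 1 +
        (aeval x (derivative g) * x ^ 2 + aeval x g * (2 * x)) := by
      conv_lhs => rw [hfg]
      simp only [map_add, derivative_mul, derivative_C, derivative_X, map_mul, aeval_X, aeval_C,
        Algebra.algebraMap_self, RingHom.id_apply, map_one, map_zero]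
      ring
    rw [this]
    refine IsNilpotent.isUnit_add_left_of_commute ?_ h1 (Commute.all _ _)
    exact (Commute.all _ _).isNilpotent_add
      ((Commute.all _ _).isNilpotent_mul_right (nil_aeval x hg'))
      ((Commute.all _ _).isNilpotent_mul_right (nil_aeval x hg))
  obtain ⟨r, ⟨-, hr⟩, -⟩ := Polynomial.existsUnique_nilpotent_sub_and_aeval_eq_zero e1 e2
  obtain ⟨G, hG⟩ := dvd_iff_isRoot.2 (show f.IsRoot r by simpa [IsRoot, aeval_def] using hr)
  refine ⟨r, G, ?_, hG⟩
  have hcoef : ∀ j, f.coeff (j + 1) = G.coeff j - r * G.coeff (j + 1) := by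
    intro j
    rw [hG, sub_mul, coeff_sub, coeff_X_mul, coeff_C_mul]
  have hnil : ∀ i j, G.natDegree + 1 ≤ i + j → 1 ≤ j → IsNilpotent (G.coeff j) := by
    intro i
    induction i with
    | zero =>
      intro j hj _
      rw [coeff_eq_zero_of_natDegree_lt (by omega)]
      exact IsNilpotent.zero
    | succ i ih =>
      intro j hj h1j
      rw [show G.coeff j = f.coeff (j + 1) + r * G.coeff (j + 1) by rw [hcoef]; ring]
      exact (Commute.all _ _).isNilpotent_add (h2 _ (by omega))
        ((Commute.all _ _).isNilpotent_mul_left (ih (j + 1) (by omega) (by omega)))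
  refine isUnit_of_coeff_isUnit_isNilpotent ?_ fun i hi => hnil (G.natDegree + 1) i (by omega)
    (by omega)
  rw [show G.coeff 0 = f.coeff 1 + r * G.coeff 1 by rw [hcoef]; ring]
  exact IsNilpotent.isUnit_add_left_of_commute
    ((Commute.all _ _).isNilpotent_mul_left (hnil (G.natDegree + 1) 1 (by omega) le_rfl)) h1
      (Commute.all _ _)

end Newton

section Criterion
variable {k Z W B : Type*} [Field k] [CommRing Z] [Ring W] [Ring B] [Algebra k W] [Algebra Z W]
  [Algebra k B]

theorem eq_zero_of_C_eq_mul_X_sub_C {w r : W} {v : W[X]} (h : C w = (X - C r) * v) : w = 0 := by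
  by_cases hv : v = 0
  · rw [hv, mul_zero, C_eq_zero] at h; exact h
  · have : Nontrivial W := by
      by_contra hn
      rw [not_nontrivial_iff_subsingleton] at hn
      exact hv (Subsingleton.elim _ _)
    have := (monic_X_sub_C r).natDegree_mul' hv
    rw [← h, natDegree_C, natDegree_X_sub_C] at this
    omega

theorem nonempty_algEquiv_of_map_eq_X (φ : W[X] ≃ₐ[k] B[X]) {f : Z[X]}
    (hf : φ (f.map (algebraMap Z W)) = X) (h1 : IsUnit (f.coeff 1))
    (h2 : ∀ j, 2 ≤ j → IsNilpotent (f.coeff j)) : Nonempty (W ≃ₐ[k] B) := by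
  obtain ⟨r, g, hg, rfl⟩ := exists_eq_X_sub_C_mul_of_isNilpotent h1 h2
  obtain ⟨g', hgg'⟩ := hg.exists_right_inv
  set r' := algebraMap Z W r
  have hF : (X - C r') * g.map (algebraMap Z W) = φ.symm X := by
    rw [← hf, AlgEquiv.symm_apply_apply, Polynomial.map_mul, Polynomial.map_sub, map_X, map_C]
  have hgg : g.map (algebraMap Z W) * g'.map (algebraMap Z W) = 1 := by
    rw [← Polynomial.map_mul, hgg', Polynomial.map_one]
  have hXr : φ (X - C r') = X * φ (g'.map (algebraMap Z W)) := by
    rw [← AlgEquiv.apply_symm_apply φ X, ← map_mul, ← hF, mul_assoc, hgg, mul_one]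
  have hc : ∀ c : k, constantCoeff (algebraMap k B[X] c) = algebraMap k B c := fun c => by
    rw [Polynomial.algebraMap_apply]; simp
  let ev : B[X] →ₐ[k] B := { constantCoeff with commutes' := hc }
  have hev : ∀ b, ev b = b.coeff 0 := fun b => rfl
  let θ : W →ₐ[k] B := (ev.comp φ.toAlgHom).comp (CAlgHom)
  have hθ : ∀ w, θ w = (φ (C w)).coeff 0 := fun b => rfl
  refine ⟨AlgEquiv.ofBijective θ ⟨?_, ?_⟩⟩
  · rw [injective_iff_map_eq_zero]
    intro w hw
    rw [hθ] at hw
    have h3 : φ (C w) = X * divX (φ (C w)) := by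
      conv_lhs => rw [← X_mul_divX_add (φ (C w)), hw]
      simp
    refine eq_zero_of_C_eq_mul_X_sub_C (r := r')
      (v := g.map (algebraMap Z W) * φ.symm (divX (φ (C w)))) ?_
    rw [← mul_assoc, hF, ← map_mul, ← h3, AlgEquiv.symm_apply_apply]
  · intro b
    have hm : (X - C r').Monic := monic_X_sub_C r'
    have h4 := modByMonic_add_div (φ.symm (C b)) (X - C r')
    have h5 : ∃ w, φ.symm (C b) %ₘ (X - C r') = C w := by
      rcases subsingleton_or_nontrivial W with hs | hs
      · exact ⟨0, Subsingleton.elim _ _⟩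
      · have := degree_modByMonic_lt (φ.symm (C b)) hm
        rw [degree_X_sub_C, ← Nat.cast_one, degree_lt_iff_coeff_zero] at this
        refine ⟨_, eq_C_of_natDegree_le_zero ?_⟩
        rw [natDegree_le_iff_coeff_eq_zero]
        intro N hN
        exact this N hN
    obtain ⟨w, hw⟩ := h5
    refine ⟨w, ?_⟩
    rw [hθ]
    rw [hw] at h4
    have h6 := congrArg φ h4
    rw [map_add, map_mul, AlgEquiv.apply_symm_apply, hXr, mul_assoc] at h6
    have h7 := congrArg (fun p => coeff p 0) h6
    simpa [mul_coeff_zero] using h7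

end Criterion

section CenterDerivation
variable {k Z W B : Type*} [Field k] [CommRing Z] [Ring W] [Ring B] [Algebra k W] [Algebra Z W]
  [Algebra k B] [Algebra k Z] [IsScalarTower k Z W]

theorem isLND_derivative : IsLND (derivative (R := B)).toAddMonoidHom where
  leibniz _ _ := derivative_mul
  nil a := ⟨a.natDegree + 1, iterate_derivative_eq_zero (Nat.lt_succ_self _)⟩

theorem IsLND.conj {R S : Type*} [Ring R] [Ring S] (φ : R ≃+* S) {d : S →+ S} (hd : IsLND d) :
    IsLND ((φ.symm.toRingHom.toAddMonoidHom.comp d).comp φ.toRingHom.toAddMonoidHom) where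
  leibniz a b := by simp [hd.leibniz]
  nil a := by
    obtain ⟨n, hn⟩ := hd.nil (φ a)
    refine ⟨n, ?_⟩
    have : ∀ n (a : R), (⇑((φ.symm.toRingHom.toAddMonoidHom.comp d).comp
        φ.toRingHom.toAddMonoidHom))^[n] a = φ.symm (d^[n] (φ a)) := by
      intro n
      induction n with
      | zero => intro a; simp
      | succ n ih => intro a; rw [Function.iterate_succ_apply, ih]; simp
    rw [this, hn, map_zero]

theorem mem_range_map_of_commute
    (hcen : ∀ w : W, (∀ v, v * w = w * v) → ∃ z : Z, algebraMap Z W z = w) {u : W[X]}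
    (hu : ∀ v, v * u = u * v) : ∃ f : Z[X], f.map (algebraMap Z W) = u := by
  have : u ∈ (mapRingHom (algebraMap Z W)).range := by
    rw [Polynomial.mem_map_range]
    intro n
    refine hcen _ fun v => ?_
    have := congrArg (fun p => coeff p n) (hu (C v))
    simpa using this
  exact this

theorem map_algebraMap_commute (f : Z[X]) (v : W[X]) :
    v * f.map (algebraMap Z W) = f.map (algebraMap Z W) * v := by
  induction f using Polynomial.induction_on' with
  | add f g hf hg => rw [Polynomial.map_add, mul_add, add_mul, hf, hg]
  | monomial n a =>
    rw [← C_mul_X_pow_eq_monomial, Polynomial.map_mul, Polynomial.map_pow, map_X, map_C]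
    have h1 : v * C (algebraMap Z W a) = C (algebraMap Z W a) * v := by
      ext i
      rw [coeff_mul_C, coeff_C_mul, Algebra.commutes]
    rw [← mul_assoc, h1, mul_assoc, mul_assoc, Polynomial.X_pow_mul]

theorem exists_center_derivation (hinj : Function.Injective (algebraMap Z W))
    (hcen : ∀ w : W, (∀ v, v * w = w * v) → ∃ z : Z, algebraMap Z W z = w)
    (φ : W[X] ≃ₐ[k] B[X]) :
    ∃ (δ : W[X] →+ W[X]) (Δ : Z[X] →+ Z[X]) (f : Z[X]), IsLND δ ∧ IsLND Δ ∧
      (∀ v, (Δ v).map (algebraMap Z W) = δ (v.map (algebraMap Z W))) ∧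
      (∀ c : k, δ (algebraMap k W[X] c) = 0) ∧
      (∀ c : k, Δ (algebraMap k Z[X] c) = 0) ∧ φ (f.map (algebraMap Z W)) = X ∧ Δ f = 1 := by
  let δ := (φ.toRingEquiv.symm.toRingHom.toAddMonoidHom.comp
    (derivative (R := B)).toAddMonoidHom).comp φ.toRingEquiv.toRingHom.toAddMonoidHom
  have hδ : IsLND δ := IsLND.conj φ.toRingEquiv isLND_derivative
  have hδa : ∀ v, δ v = φ.symm (derivative (φ v)) := fun v => rfl
  have hinj' : Function.Injective (Polynomial.map (algebraMap Z W)) := Polynomial.map_injective _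
    hinj
  have hex : ∀ v : Z[X], ∃ u : Z[X], u.map (algebraMap Z W) = δ (v.map (algebraMap Z W)) := by
    intro v
    refine mem_range_map_of_commute hcen fun w => ?_
    have h1 := congrArg δ (map_algebraMap_commute v w)
    rw [hδ.leibniz, hδ.leibniz, map_algebraMap_commute v (δ w), add_comm] at h1
    exact add_right_cancel h1
  choose D hD using hex
  let Δ : Z[X] →+ Z[X] := AddMonoidHom.mk' D fun a b => hinj' (by
    simp only [Polynomial.map_add, hD, map_add])
  have hΔ : ∀ v, (Δ v).map (algebraMap Z W) = δ (v.map (algebraMap Z W)) := hD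
  have hit : ∀ n v, (Δ^[n] v).map (algebraMap Z W) = δ^[n] (v.map (algebraMap Z W)) := by
    intro n
    induction n with
    | zero => intro v; rfl
    | succ n ih => intro v; rw [Function.iterate_succ_apply, ih, hΔ, Function.iterate_succ_apply]
  have hk : ∀ c : k, δ (algebraMap k W[X] c) = 0 := fun c => by
    rw [hδa, AlgEquiv.commutes, Polynomial.algebraMap_apply, derivative_C, map_zero]
  obtain ⟨f, hf⟩ := mem_range_map_of_commute hcen (u := φ.symm X) fun v => by
    apply φ.injective
    simp [X_mul]
  refine ⟨δ, Δ, f, hδ, ⟨?_, ?_⟩, hΔ, hk, ?_, ?_, ?_⟩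
  · intro a b
    apply hinj'
    simp only [Polynomial.map_add, Polynomial.map_mul, hΔ, hδ.leibniz]
  · intro a
    obtain ⟨n, hn⟩ := hδ.nil (a.map (algebraMap Z W))
    exact ⟨n, hinj' (by rw [hit, hn, Polynomial.map_zero])⟩
  · intro c
    apply hinj'
    rw [hΔ, Polynomial.algebraMap_apply, map_C, ← IsScalarTower.algebraMap_apply,
      ← Polynomial.algebraMap_apply, hk, Polynomial.map_zero]
  · rw [hf, AlgEquiv.apply_symm_apply]
  · apply hinj'
    rw [hΔ, hf, hδa, AlgEquiv.apply_symm_apply, derivative_X, map_one, Polynomial.map_one]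

end CenterDerivation

namespace QGWA

section Single
variable {k W : Type*} [Field k] [Ring W] [Algebra k W]

theorem aeval_smul_eq (c : k) (t : W) (P : k[X]) :
    aeval (c • t) P = aeval t (P.comp (C c * X)) := by
  rw [aeval_comp]
  simp [Algebra.smul_def]

theorem pow_mul_eq {q : k} {x t : W} (hxt : x * t = q • (t * x)) (j : ℕ) :
    x ^ j * t = q ^ j • (t * x ^ j) := by
  induction j with
  | zero => simp
  | succ j ih =>
    rw [pow_succ, mul_assoc, hxt, mul_smul_comm, ← mul_assoc, ih, smul_mul_assoc, smul_smul,
      mul_assoc, pow_succ, mul_comm q]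

theorem mul_pow_eq {q : k} {x t : W} (hxt : x * t = q • (t * x)) (j : ℕ) :
    x * t ^ j = q ^ j • (t ^ j * x) := by
  induction j with
  | zero => simp
  | succ j ih =>
    rw [pow_succ, ← mul_assoc, ih, smul_mul_assoc, mul_assoc, hxt, mul_smul_comm, smul_smul,
      ← mul_assoc, pow_succ]

theorem mul_aeval_eq {q : k} {x t : W} (hxt : x * t = q • (t * x)) (P : k[X]) :
    x * aeval t P = aeval t (P.comp (C q * X)) * x := by
  rw [← aeval_smul_eq]
  induction P using Polynomial.induction_on' with
  | add f g hf hg => rw [map_add, map_add, mul_add, add_mul, hf, hg]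
  | monomial n a =>
    rw [aeval_monomial, aeval_monomial, _root_.smul_pow, mul_smul_comm, smul_mul_assoc, ← mul_assoc,
      ← Algebra.commutes, mul_assoc, mul_pow_eq hxt, mul_smul_comm, mul_assoc]

theorem pow_mul_aeval_eq {q : k} {x t : W} (hxt : x * t = q • (t * x)) (P : k[X]) (j : ℕ) :
    x ^ j * aeval t P = aeval t (P.comp (C (q ^ j) * X)) * x ^ j :=
  mul_aeval_eq (pow_mul_eq hxt j) P

theorem comp_comp_scale (P : k[X]) (a b : k) :
    (P.comp (C a * X)).comp (C b * X) = P.comp (C (a * b) * X) := by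
  rw [comp_assoc]; congr 1; simp [mul_assoc]

theorem comp_one_scale (P : k[X]) : P.comp (C 1 * X) = P := by simp

theorem aeval_mul_pow_eq {q : k} (hq : q ≠ 0) {x t : W} (hxt : x * t = q • (t * x)) (P : k[X])
    (j : ℕ) : aeval t P * x ^ j = x ^ j * aeval t (P.comp (C (q⁻¹ ^ j) * X)) := by
  rw [pow_mul_aeval_eq hxt, comp_comp_scale, ← mul_pow, inv_mul_cancel₀ hq, one_pow,
    comp_one_scale]

theorem pow_commute_of_rel {q : k} {x y t : W} {h : k[X]}
    (hxt : x * t = q • (t * x)) (hxy : x * y = aeval t h) (hyx : y * x = aeval (q⁻¹ • t) h)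
    {n : ℕ} (hn : q ^ n = 1) : x ^ n * y = y * x ^ n := by
  rcases n with _ | n
  · simp
  · rw [pow_succ, mul_assoc, hxy, pow_mul_aeval_eq hxt, ← pow_succ, pow_succ', ← mul_assoc, hyx,
      aeval_smul_eq]
    congr 3
    rw [inv_eq_of_mul_eq_one_left (by rw [← pow_succ, hn])]

/-- The homogeneous generator of degree `d`: a power of `x` or of `y`. -/
def hom (x y : W) (d : ℤ) : W := x ^ d.toNat * y ^ (-d).toNat

theorem hom_natCast (x y : W) (d : ℕ) : hom x y d = x ^ d := by simp [hom]

theorem hom_neg_natCast (x y : W) (d : ℕ) : hom x y (-d) = y ^ d := by simp [hom]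

theorem hom_zero (x y : W) : hom x y 0 = 1 := by simp [hom]

theorem hom_swap (x y : W) (d : ℤ) : hom y x (-d) = hom x y d := by
  obtain ⟨n, rfl | rfl⟩ := d.eq_nat_or_neg
  · rw [hom_neg_natCast, hom_natCast]
  · rw [neg_neg, hom_neg_natCast, hom_natCast]

theorem mul_hom_left {q : k} (hq : q ≠ 0) {x y t : W} {h : k[X]}
    (hyt : y * t = q⁻¹ • (t * y)) (hxy : x * y = aeval t h) (d : ℤ) :
    ∃ P : k[X], x * hom x y d = hom x y (d + 1) * aeval t P := by
  obtain ⟨n, rfl | rfl⟩ := d.eq_nat_or_neg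
  · refine ⟨1, ?_⟩
    rw [hom_natCast, show ((n : ℤ) + 1) = ((n + 1 : ℕ) : ℤ) by push_cast; rfl, hom_natCast, map_one,
      mul_one, pow_succ']
  · rcases n with _ | n
    · refine ⟨1, ?_⟩
      rw [show (-((0 : ℕ) : ℤ) + 1) = ((1 : ℕ) : ℤ) by simp, hom_natCast, hom_neg_natCast]
      simp
    · rw [show (-((n + 1 : ℕ) : ℤ) + 1) = -(n : ℤ) by push_cast; ring, hom_neg_natCast,
        hom_neg_natCast, pow_succ', ← mul_assoc, hxy, aeval_mul_pow_eq (inv_ne_zero hq) hyt]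
      exact ⟨_, rfl⟩

theorem mul_hom_scalar {q : k} (hq : q ≠ 0) {x y t : W} (hxt : x * t = q • (t * x))
    (hyt : y * t = q⁻¹ • (t * y)) (d : ℤ) : t * hom x y d = q⁻¹ ^ d • (hom x y d * t) := by
  obtain ⟨n, rfl | rfl⟩ := d.eq_nat_or_neg
  · rw [hom_natCast, pow_mul_eq hxt, smul_smul, zpow_natCast, ← mul_pow, inv_mul_cancel₀ hq,
      one_pow, one_smul]
  · rw [hom_neg_natCast, pow_mul_eq hyt, smul_smul, zpow_neg, zpow_natCast, ← inv_pow, inv_inv,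
      ← mul_pow, mul_inv_cancel₀ hq, one_pow, one_smul]

theorem commute_hom {x y a : W} (hx : Commute a x) (hy : Commute a y) (d : ℤ) :
    Commute a (hom x y d) := (hx.pow_right _).mul_right (hy.pow_right _)

end Single

/-- The defining relations of a quantum generalized Weyl algebra, for elements of an algebra. -/
structure Rel {k W : Type*} [Field k] [Ring W] [Algebra k W] {m : ℕ} (q : Fin m → k)
    (h : Fin m → k[X]) (x y : Fin m → W) (t : W) : Prop where
  xt : ∀ i, x i * t = q i • (t * x i)
  yt : ∀ i, y i * t = (q i)⁻¹ • (t * y i)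
  xy : ∀ i, x i * y i = aeval t (h i)
  yx : ∀ i, y i * x i = aeval ((q i)⁻¹ • t) (h i)
  xx : ∀ i j, i ≠ j → x i * x j = x j * x i
  yy : ∀ i j, i ≠ j → y i * y j = y j * y i
  xyc : ∀ i j, i ≠ j → x i * y j = y j * x i

/-- The subalgebra generated by `t` and the generators with index in `S`. -/
def sub (k : Type*) {W : Type*} [Field k] [Ring W] [Algebra k W] {m : ℕ} (x y : Fin m → W) (t : W)
    (S : Set (Fin m)) : Subalgebra k W :=
  Algebra.adjoin k (insert t (x '' S ∪ y '' S))

section Sub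
variable {k W : Type*} [Field k] [Ring W] [Algebra k W] {m : ℕ} {q : Fin m → k}
    {h : Fin m → k[X]} {x y : Fin m → W} {t : W} {S : Set (Fin m)}

theorem t_mem_sub : t ∈ sub k x y t S := Algebra.subset_adjoin (by simp)

theorem x_mem_sub {i : Fin m} (hi : i ∈ S) : x i ∈ sub k x y t S :=
  Algebra.subset_adjoin (Or.inr (Or.inl ⟨i, hi, rfl⟩))

theorem y_mem_sub {i : Fin m} (hi : i ∈ S) : y i ∈ sub k x y t S :=
  Algebra.subset_adjoin (Or.inr (Or.inr ⟨i, hi, rfl⟩))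

theorem aeval_mem_sub (P : k[X]) : aeval t P ∈ sub k x y t S := by
  rw [aeval_eq_sum_range]
  exact sum_mem fun i _ => Subalgebra.smul_mem _ (pow_mem t_mem_sub i) _

theorem sub_swap : sub k y x t S = sub k x y t S := by
  rw [sub, sub, Set.union_comm]

theorem sub_induction {p : W → Prop} (ht : p t) (hx : ∀ i ∈ S, p (x i)) (hy : ∀ i ∈ S, p (y i))
    (halg : ∀ c : k, p (algebraMap k W c)) (hadd : ∀ a b, p a → p b → p (a + b))
    (hmul : ∀ a b, p a → p b → p (a * b)) {w : W} (hw : w ∈ sub k x y t S) : p w := by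
  refine Algebra.adjoin_induction ?_ halg (fun a b _ _ => hadd a b) (fun a b _ _ => hmul a b) hw
  rintro _ (rfl | ⟨i, hi, rfl⟩ | ⟨i, hi, rfl⟩)
  exacts [ht, hx i hi, hy i hi]

theorem commute_of_mem_sub {v w : W} (ht : Commute v t) (hx : ∀ i ∈ S, Commute v (x i))
    (hy : ∀ i ∈ S, Commute v (y i)) (hw : w ∈ sub k x y t S) : Commute v w :=
  sub_induction (p := fun w => Commute v w) ht hx hy (fun c => (Algebra.commutes c v).symm)
    (fun _ _ h1 h2 => h1.add_right h2) (fun _ _ h1 h2 => h1.mul_right h2) hw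

namespace Rel
variable (H : Rel q h x y t)
include H

theorem swap (hq : ∀ i, q i ≠ 0) :
    Rel (fun i => (q i)⁻¹) (fun i => (h i).comp (C (q i)⁻¹ * X)) y x t where
  xt := H.yt
  yt i := by rw [inv_inv]; exact H.xt i
  xy i := by rw [H.yx, aeval_smul_eq]
  yx i := by
    rw [H.xy, aeval_smul_eq, comp_comp_scale, inv_inv, inv_mul_cancel₀ (hq i), comp_one_scale]
  xx := H.yy
  yy := H.xx
  xyc i j hij := (H.xyc j i hij.symm).symm

theorem commute_x_y {i j : Fin m} (hij : i ≠ j) (a : ℕ) :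
    Commute (x i ^ a) (x j) ∧ Commute (x i ^ a) (y j) :=
  ⟨Commute.pow_left (H.xx i j hij) _, Commute.pow_left (H.xyc i j hij) _⟩

theorem xpow_commute {n : Fin m → ℕ} (hn : ∀ i, q i ^ n i = 1) (i : Fin m)
    {w : W} (hw : w ∈ sub k x y t S) : Commute (x i ^ n i) w := by
  refine commute_of_mem_sub ?_ ?_ ?_ hw
  · have := pow_mul_eq (H.xt i) (n i)
    rwa [hn, one_smul] at this
  · intro j _
    by_cases hij : i = j
    · subst hij; exact (Commute.refl _).pow_left _
    · exact (H.commute_x_y hij _).1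
  · intro j _
    by_cases hij : i = j
    · subst hij; exact pow_commute_of_rel (H.xt i) (H.xy i) (H.yx i) (hn i)
    · exact (H.commute_x_y hij _).2

theorem ypow_commute (hq : ∀ i, q i ≠ 0) {n : Fin m → ℕ} (hn : ∀ i, q i ^ n i = 1) (i : Fin m)
    {w : W} (hw : w ∈ sub k x y t S) : Commute (y i ^ n i) w := by
  refine (H.swap hq).xpow_commute (n := n) (fun i => ?_) i (S := S)
    (by rwa [sub_swap])
  rw [inv_pow, hn, inv_one]

theorem tpow_commute {N : ℕ} (hN : ∀ i, q i ^ N = 1)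
    {w : W} (hw : w ∈ sub k x y t S) : Commute (t ^ N) w := by
  refine commute_of_mem_sub ((Commute.refl _).pow_left _) ?_ ?_ hw
  · intro i _
    have := mul_pow_eq (H.xt i) N
    rw [hN, one_smul] at this
    exact this.symm
  · intro i _
    have := mul_pow_eq (H.yt i) N
    rw [inv_pow, hN, inv_one, one_smul] at this
    exact this.symm

/-- Elements generated by `S ∪ {i}` are combinations of homogeneous elements in degree `i`. -/
theorem mem_iSup_hom (hq : ∀ i, q i ≠ 0) {i : Fin m} (hi : i ∉ S) {w : W}
    (hw : w ∈ sub k x y t (insert i S)) :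
    w ∈ ⨆ d : ℤ, (sub k x y t S).toSubmodule.map (LinearMap.mulLeft k (hom (x i) (y i) d)) := by
  set N := ⨆ d : ℤ, (sub k x y t S).toSubmodule.map (LinearMap.mulLeft k (hom (x i) (y i) d))
    with hN
  have hmem : ∀ d, ∀ a ∈ sub k x y t S, hom (x i) (y i) d * a ∈ N := fun d a ha =>
    Submodule.mem_iSup_of_mem d ⟨a, ha, rfl⟩
  have hgen : ∀ g : W, (∀ d, ∀ a ∈ sub k x y t S, g * (hom (x i) (y i) d * a) ∈ N) →
      ∀ v ∈ N, g * v ∈ N := by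
    intro g hg v hv
    induction hv using Submodule.iSup_induction' with
    | mem d v hv =>
      obtain ⟨a, ha, rfl⟩ := hv
      exact hg d a ha
    | zero => simp
    | add v v' _ _ hv hv' => rw [mul_add]; exact N.add_mem hv hv'
  have hne : ∀ j ∈ S, j ≠ i := fun j hj hji => hi (hji ▸ hj)
  have key : ∀ v ∈ N, w * v ∈ N := by
    refine sub_induction (p := fun w => ∀ v ∈ N, w * v ∈ N) ?_ ?_ ?_ ?_ ?_ ?_ hw
    · refine hgen t fun d a ha => ?_
      rw [← mul_assoc, mul_hom_scalar (hq i) (H.xt i) (H.yt i), smul_mul_assoc, mul_assoc]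
      exact N.smul_mem _ (hmem d _ (mul_mem t_mem_sub ha))
    · rintro j (rfl | hj)
      · refine hgen _ fun d a ha => ?_
        obtain ⟨P, hP⟩ := mul_hom_left (hq j) (H.yt j) (H.xy j) d
        rw [← mul_assoc, hP, mul_assoc]
        exact hmem _ _ (mul_mem (aeval_mem_sub P) ha)
      · refine hgen _ fun d a ha => ?_
        rw [← mul_assoc, (commute_hom (H.xx j i (hne j hj)) (H.xyc j i (hne j hj)) d).eq, mul_assoc]
        exact hmem _ _ (mul_mem (x_mem_sub hj) ha)
    · rintro j (rfl | hj)
      · refine hgen _ fun d a ha => ?_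
        have H' := H.swap hq
        obtain ⟨P, hP⟩ := mul_hom_left (inv_ne_zero (hq j)) (H'.yt j) (H'.xy j) (-d)
        rw [hom_swap] at hP
        rw [← mul_assoc, hP, mul_assoc, show -d + 1 = -(d - 1) by ring, hom_swap]
        exact hmem _ _ (mul_mem (aeval_mem_sub P) ha)
      · refine hgen _ fun d a ha => ?_
        rw [← mul_assoc, (commute_hom (H.xyc i j (hne j hj).symm).symm (H.yy j i (hne j hj)) d).eq,
          mul_assoc]
        exact hmem _ _ (mul_mem (y_mem_sub hj) ha)
    · intro c v hv
      rw [← Algebra.smul_def]; exact N.smul_mem _ hv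
    · intro a b ha hb v hv
      rw [add_mul]; exact N.add_mem (ha v hv) (hb v hv)
    · intro a b ha hb v hv
      rw [mul_assoc]; exact ha _ (hb v hv)
  have h1 : (1 : W) ∈ N := by
    have := hmem 0 1 (one_mem _)
    rwa [hom_zero, mul_one] at this
  have := key 1 h1
  rwa [mul_one] at this

theorem exists_finsupp_hom (hq : ∀ i, q i ≠ 0) {i : Fin m} (hi : i ∉ S) {w : W}
    (hw : w ∈ sub k x y t (insert i S)) :
    ∃ a : ℤ →₀ W, (∀ d, a d ∈ sub k x y t S) ∧ w = a.sum fun d a => hom (x i) (y i) d * a := by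
  have h1 := H.mem_iSup_hom hq hi hw
  clear hw
  induction h1 using Submodule.iSup_induction' with
  | mem d v hv =>
    obtain ⟨a, ha, rfl⟩ := hv
    classical
    refine ⟨Finsupp.single d a, ?_, ?_⟩
    · intro d'
      rw [Finsupp.single_apply]
      split_ifs
      exacts [ha, zero_mem _]
    · rw [Finsupp.sum_single_index (by simp)]; rfl
  | zero => exact ⟨0, fun _ => zero_mem _, by simp⟩
  | add v v' hv1 hv1' hv hv' =>
    obtain ⟨a, ha, rfl⟩ := hv
    obtain ⟨b, hb, rfl⟩ := hv'
    refine ⟨a + b, fun d => add_mem (ha d) (hb d), ?_⟩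
    rw [Finsupp.sum_add_index'] <;> simp [mul_add]

end Rel
end Sub
end QGWA

namespace QGWA

section Finite
variable {k W : Type*} [Field k] [Ring W] [Algebra k W] {m : ℕ} {q : Fin m → k}
    {h : Fin m → k[X]} {x y : Fin m → W} {t : W}
variable {A : Type*} [CommRing A] [Algebra k A] [Algebra A W] [IsScalarTower k A W]

theorem exists_pow_eq_smul {w : W} {n : ℕ} (h : w ^ n ∈ (algebraMap A W).range) (j : ℕ) :
    ∃ a : A, w ^ j = a • w ^ (j % n) := by
  obtain ⟨a, ha⟩ := h
  refine ⟨a ^ (j / n), ?_⟩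
  rw [Algebra.smul_def, map_pow, ha, ← pow_mul, ← pow_add, Nat.div_add_mod]

theorem Rel.exists_fg (H : Rel q h x y t) (hq : ∀ i, q i ≠ 0) {n : Fin m → ℕ} {N : ℕ}
    (hn : ∀ i, 0 < n i) (hN : 0 < N) (hT : t ^ N ∈ (algebraMap A W).range)
    (hX : ∀ i, x i ^ n i ∈ (algebraMap A W).range) (hY : ∀ i, y i ^ n i ∈ (algebraMap A W).range)
    (S : Finset (Fin m)) : ∃ M : Submodule A W, M.FG ∧ ∀ w ∈ sub k x y t S, w ∈ M := by
  classical
  induction S using Finset.induction_on with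
  | empty =>
    refine ⟨Submodule.span A ((Finset.range N).image fun i => t ^ i), ⟨_, rfl⟩, ?_⟩
    intro w hw
    rw [sub] at hw
    simp only [Finset.coe_empty, Set.image_empty, Set.union_empty, insert_empty_eq] at hw
    rw [Algebra.adjoin_singleton_eq_range_aeval] at hw
    obtain ⟨P, rfl⟩ := hw
    rw [AlgHom.toRingHom_eq_coe, RingHom.coe_coe, aeval_eq_sum_range]
    refine Submodule.sum_mem _ fun i _ => ?_
    obtain ⟨a, ha⟩ := exists_pow_eq_smul hT i
    rw [ha, ← IsScalarTower.algebraMap_smul A (P.coeff i)]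
    refine Submodule.smul_mem _ _ (Submodule.smul_mem _ _ (Submodule.subset_span ?_))
    simpa using ⟨i % N, Nat.mod_lt _ hN, rfl⟩
  | insert i S hi ih =>
    obtain ⟨M, hM, hSM⟩ := ih
    refine ⟨⨆ r ∈ Finset.range (n i), (M.map (LinearMap.mulLeft A (x i ^ r)) ⊔
      M.map (LinearMap.mulLeft A (y i ^ r))), ?_, ?_⟩
    · exact Submodule.fg_biSup _ _ fun r _ => (hM.map _).sup (hM.map _)
    · intro w hw
      rw [Finset.coe_insert] at hw
      obtain ⟨a, ha, rfl⟩ := H.exists_finsupp_hom hq (by simpa using hi) hw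
      refine Submodule.sum_mem _ fun d _ => ?_
      obtain ⟨e, rfl | rfl⟩ := d.eq_nat_or_neg
      · simp only [hom_natCast]
        obtain ⟨c, hc⟩ := exists_pow_eq_smul (hX i) e
        rw [hc, smul_mul_assoc]
        refine Submodule.smul_mem _ _ ?_
        refine Submodule.mem_iSup_of_mem (e % n i) (Submodule.mem_iSup_of_mem ?_ ?_)
        · exact Finset.mem_range.2 (Nat.mod_lt _ (hn i))
        · exact Submodule.mem_sup_left ⟨_, hSM _ (ha _), rfl⟩
      · simp only [hom_neg_natCast]
        obtain ⟨c, hc⟩ := exists_pow_eq_smul (hY i) e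
        rw [hc, smul_mul_assoc]
        refine Submodule.smul_mem _ _ ?_
        refine Submodule.mem_iSup_of_mem (e % n i) (Submodule.mem_iSup_of_mem ?_ ?_)
        · exact Finset.mem_range.2 (Nat.mod_lt _ (hn i))
        · exact Submodule.mem_sup_right ⟨_, hSM _ (ha _), rfl⟩

theorem Rel.finite (H : Rel q h x y t) (hq : ∀ i, q i ≠ 0) {n : Fin m → ℕ} {N : ℕ}
    (hn : ∀ i, 0 < n i) (hN : 0 < N) (hT : t ^ N ∈ (algebraMap A W).range)
    (hX : ∀ i, x i ^ n i ∈ (algebraMap A W).range) (hY : ∀ i, y i ^ n i ∈ (algebraMap A W).range)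
    (hgen : sub k x y t Set.univ = ⊤) : Module.Finite A W := by
  obtain ⟨M, hM, hw⟩ := H.exists_fg hq hn hN hT hX hY Finset.univ
  have : M = ⊤ := by
    rw [eq_top_iff]
    intro w _
    refine hw w ?_
    rw [Finset.coe_univ, hgen]
    trivial
  exact ⟨this ▸ hM⟩

theorem mem_radical_span_of_eq_mul (hinj : Function.Injective (algebraMap A W)) {z a : A} {w : W}
    (hw : IsIntegral A w) (hz : algebraMap A W z = algebraMap A W a * w) :
    z ∈ (Ideal.span {a}).radical := by
  obtain ⟨P, hP, hPw⟩ := hw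
  have h1 := scaleRoots_eval₂_mul_of_commute (p := P) (algebraMap A W) w a
    (Algebra.commutes a w) (fun c c' => by
      rw [Commute, SemiconjBy, Algebra.commutes])
  rw [hPw, mul_zero, ← hz] at h1
  have h2 : (P.scaleRoots a).eval z = 0 := by
    apply hinj
    rw [map_zero, ← h1, ← eval₂_id, hom_eval₂, RingHom.comp_id]
  refine ⟨P.natDegree, ?_⟩
  have hz0 : ∀ Q : A[X], Q.Monic → (∀ i < Q.natDegree, Q.coeff i ∈ Ideal.span {a}) → Q.eval z = 0 →
      z ^ Q.natDegree ∈ Ideal.span {a} := by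
    intro Q hQ hQc h0
    rw [eval_eq_sum_range, Finset.sum_range_succ, hQ.coeff_natDegree, one_mul] at h0
    rw [eq_neg_of_add_eq_zero_right h0]
    refine neg_mem (sum_mem fun i hi => ?_)
    exact Ideal.mul_mem_right _ _ (hQc i (Finset.mem_range.1 hi))
  have h3 := hz0 (P.scaleRoots a) ((monic_scaleRoots_iff a).2 hP) ?_ h2
  · rwa [natDegree_scaleRoots] at h3
  · intro i hi
    rw [natDegree_scaleRoots] at hi
    rw [coeff_scaleRoots]
    refine Ideal.mul_mem_left _ _ (Ideal.pow_mem_of_mem _ (Ideal.mem_span_singleton_self a) _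
      (by omega))

end Finite
end QGWA

namespace QGWA

/-- An algebra presented by the relations of a quantum generalized Weyl algebra. -/
structure IsQGWA {k : Type v} {W : Type u} [Field k] [Ring W] [Algebra k W] {m : ℕ} (q : Fin m → k)
    (h : Fin m → k[X]) (x y : Fin m → W) (t : W) : Prop extends Rel q h x y t where
  gen : sub k x y t Set.univ = ⊤
  lift : ∀ {A : Type u} [Ring A] [Algebra k A] (x' y' : Fin m → A) (t' : A), Rel q h x' y' t' →
    ∃ φ : W →ₐ[k] A, (∀ i, φ (x i) = x' i) ∧ (∀ i, φ (y i) = y' i) ∧ φ t = t'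

section General
variable {k W A : Type*} [Field k] [Ring W] [Algebra k W] [Ring A] [Algebra k A] {m : ℕ}
  {q : Fin m → k} {h : Fin m → k[X]} {x y : Fin m → W} {t : W} {S : Set (Fin m)}

theorem Rel.map (H : Rel q h x y t) (φ : W →ₐ[k] A) :
    Rel q h (fun i => φ (x i)) (fun i => φ (y i)) (φ t) where
  xt i := by rw [← map_mul, H.xt, map_smul, map_mul]
  yt i := by rw [← map_mul, H.yt, map_smul, map_mul]
  xy i := by rw [← map_mul, H.xy, aeval_algHom_apply]
  yx i := by rw [← map_mul, H.yx, ← map_smul, aeval_algHom_apply]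
  xx i j hij := by rw [← map_mul, H.xx i j hij, map_mul]
  yy i j hij := by rw [← map_mul, H.yy i j hij, map_mul]
  xyc i j hij := by rw [← map_mul, H.xyc i j hij, map_mul]

theorem algHom_eq_of_mem_sub {φ ψ : W →ₐ[k] A} (ht : φ t = ψ t) (hx : ∀ i ∈ S, φ (x i) = ψ (x i))
    (hy : ∀ i ∈ S, φ (y i) = ψ (y i)) {w : W} (hw : w ∈ sub k x y t S) : φ w = ψ w :=
  sub_induction (p := fun w => φ w = ψ w) ht hx hy (fun c => by simp)
    (fun a b ha hb => by rw [map_add, map_add, ha, hb])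
    (fun a b ha hb => by rw [map_mul, map_mul, ha, hb]) hw

theorem Rel.of_comm {A : Type*} [CommRing A] [Algebra k A] {x y : Fin m → A}
    (hxy : ∀ i, x i * y i = algebraMap k A ((h i).coeff 0)) : Rel q h x y 0 where
  xt i := by simp
  yt i := by simp
  xy i := by rw [hxy, coeff_zero_eq_aeval_zero']
  yx i := by rw [mul_comm, hxy, smul_zero, coeff_zero_eq_aeval_zero']
  xx i j _ := mul_comm _ _
  yy i j _ := mul_comm _ _
  xyc i j _ := mul_comm _ _

theorem Rel.commute_of_t_eq_zero (H : Rel q h x y 0) {v w : W} (hv : v ∈ sub k x y 0 Set.univ)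
    (hw : w ∈ sub k x y 0 Set.univ) : Commute v w := by
  have hxy : ∀ i j, Commute (x i) (y j) := fun i j => by
    by_cases hij : i = j
    · subst hij
      have h1 := H.xy i
      have h2 := H.yx i
      rw [smul_zero] at h2
      rw [Commute, SemiconjBy, h1, h2]
    · exact H.xyc i j hij
  refine commute_of_mem_sub (Commute.zero_right _) ?_ ?_ hw
  · intro i _
    refine Commute.symm (commute_of_mem_sub (Commute.zero_right _) ?_ ?_ hv)
    · intro j _
      by_cases hij : i = j
      · rw [hij]
      · exact H.xx i j hij
    · intro j _; exact hxy i j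
  · intro i _
    refine Commute.symm (commute_of_mem_sub (Commute.zero_right _) ?_ ?_ hv)
    · intro j _
      exact (hxy j i).symm
    · intro j _
      by_cases hij : i = j
      · rw [hij]
      · exact H.yy i j hij

theorem Rel.exists_t_mul (H : Rel q h x y t) (hq : ∀ i, q i ≠ 0) {w : W} (hw : w ∈ sub k x y t S) :
    (∃ v, w * t = t * v) ∧ ∃ v, t * w = v * t := by
  refine sub_induction (p := fun w => (∃ v, w * t = t * v) ∧ ∃ v, t * w = v * t)
    ⟨⟨t, rfl⟩, ⟨t, rfl⟩⟩ ?_ ?_ ?_ ?_ ?_ hw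
  · intro i _
    refine ⟨⟨q i • x i, ?_⟩, ⟨(q i)⁻¹ • x i, ?_⟩⟩
    · rw [H.xt, mul_smul_comm]
    · rw [smul_mul_assoc, H.xt, smul_smul, inv_mul_cancel₀ (hq i), one_smul]
  · intro i _
    refine ⟨⟨(q i)⁻¹ • y i, ?_⟩, ⟨q i • y i, ?_⟩⟩
    · rw [H.yt, mul_smul_comm]
    · rw [smul_mul_assoc, H.yt, smul_smul, mul_inv_cancel₀ (hq i), one_smul]
  · intro c
    exact ⟨⟨_, Algebra.commutes c t⟩, ⟨_, (Algebra.commutes c t).symm⟩⟩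
  · rintro a b ⟨⟨a1, h1⟩, ⟨a2, h2⟩⟩ ⟨⟨b1, h3⟩, ⟨b2, h4⟩⟩
    exact ⟨⟨a1 + b1, by rw [add_mul, h1, h3, mul_add]⟩, ⟨a2 + b2, by rw [mul_add, h2, h4, add_mul]⟩⟩
  · rintro a b ⟨⟨a1, h1⟩, ⟨a2, h2⟩⟩ ⟨⟨b1, h3⟩, ⟨b2, h4⟩⟩
    refine ⟨⟨a1 * b1, by rw [mul_assoc, h3, ← mul_assoc, h1, mul_assoc]⟩,
      ⟨a2 * b2, by rw [← mul_assoc, h2, mul_assoc, h4, mul_assoc]⟩⟩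

end General

namespace IsQGWA
variable {k : Type v} {W : Type u} [Field k] [Ring W] [Algebra k W] {m : ℕ} {q : Fin m → k}
    {h : Fin m → k[X]} {x y : Fin m → W} {t : W} (H : IsQGWA q h x y t)
include H

theorem mem_sub (w : W) : w ∈ sub k x y t Set.univ := by
  rw [H.gen]; trivial

theorem mem_sub_insert (i : Fin m) (w : W) : w ∈ sub k x y t (insert i {i}ᶜ) := by
  have := H.mem_sub w
  rwa [← Set.union_compl_self {i}] at this

theorem swap (hq : ∀ i, q i ≠ 0) :
    IsQGWA (fun i => (q i)⁻¹) (fun i => (h i).comp (C (q i)⁻¹ * X)) y x t where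
  toRel := H.toRel.swap hq
  gen := by rw [sub_swap, H.gen]
  lift x' y' t' h' := by
    have h1 := h'.swap fun i => inv_ne_zero (hq i)
    simp only [inv_inv, comp_comp_scale] at h1
    have h2 : ∀ i, (h i).comp (C ((q i)⁻¹ * q i) * X) = h i := fun i => by
      rw [inv_mul_cancel₀ (hq i), comp_one_scale]
    simp only [h2] at h1
    obtain ⟨φ, hx, hy, ht⟩ := H.lift y' x' t' h1
    exact ⟨φ, hy, hx, ht⟩

/-- Killing `t` and recording the degree in `x i` detects the components of an element. -/
theorem map_component_eq_zero {Q : Type u} [CommRing Q] [Algebra k Q] (π : W →ₐ[k] Q) (hπ : π t = 0)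
    (i : Fin m) {a : ℤ →₀ W} (ha : ∀ d, a d ∈ sub k x y t {i}ᶜ) {w : W}
    (hw : (a.sum fun d a => hom (x i) (y i) d * a) * x i = w * t) {d : ℤ} (hd : 0 ≤ d) :
    π (a d) = 0 := by
  classical
  let x' : Fin m → AddMonoidAlgebra Q ℤ := fun j =>
    if j = i then AddMonoidAlgebra.single 1 1 else AddMonoidAlgebra.single 0 (π (x j))
  let y' : Fin m → AddMonoidAlgebra Q ℤ := fun j =>
    if j = i then AddMonoidAlgebra.single (-1) (algebraMap k Q ((h i).coeff 0))
      else AddMonoidAlgebra.single 0 (π (y j))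
  have hrel : Rel q h x' y' 0 := Rel.of_comm fun j => by
    by_cases hj : j = i
    · subst hj
      simp only [x', y', if_true, AddMonoidAlgebra.single_mul_single, one_mul]
      rfl
    · simp only [x', y', if_neg hj, AddMonoidAlgebra.single_mul_single, ← map_mul, H.xy,
        ← aeval_algHom_apply, hπ]
      rw [← coeff_zero_eq_aeval_zero']
      rfl
  obtain ⟨χ, hχx, hχy, hχt⟩ := H.lift x' y' 0 hrel
  let ι : Q →ₐ[k] AddMonoidAlgebra Q ℤ := AddMonoidAlgebra.singleZeroAlgHom
  have hχa : ∀ w ∈ sub k x y t {i}ᶜ, χ w = AddMonoidAlgebra.single 0 (π w) := by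
    intro w hw
    refine algHom_eq_of_mem_sub (A := AddMonoidAlgebra Q ℤ) (φ := χ) (ψ := ι.comp π) ?_ ?_ ?_ hw
    · rw [hχt, AlgHom.comp_apply, hπ, map_zero]
    · intro j hj
      rw [hχx]
      exact if_neg hj
    · intro j hj
      rw [hχy]
      exact if_neg hj
  have hz : ∀ d, ∃ c : Q, (0 ≤ d → c = 1) ∧
      χ (hom (x i) (y i) d) = AddMonoidAlgebra.single d c := by
    intro d
    obtain ⟨e, rfl | rfl⟩ := d.eq_nat_or_neg
    · refine ⟨1, fun _ => rfl, ?_⟩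
      rw [hom_natCast, map_pow, hχx]
      simp [x', -LaurentPolynomial.single_eq_C_mul_T]
    · rcases e with _ | e
      · exact ⟨1, fun _ => rfl, by simp [hom_zero, AddMonoidAlgebra.one_def,
          -LaurentPolynomial.single_eq_C_mul_T]⟩
      · refine ⟨(algebraMap k Q ((h i).coeff 0)) ^ (e + 1), fun h0 => by omega, ?_⟩
        rw [hom_neg_natCast, map_pow, hχy]
        simp [y', -LaurentPolynomial.single_eq_C_mul_T]
  choose c hc hcz using hz
  have h1 := congrArg χ hw
  rw [map_mul, map_mul, hχt, mul_zero, hχx] at h1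
  have hu : IsUnit (x' i) := by
    refine IsUnit.of_mul_eq_one (AddMonoidAlgebra.single (-1) 1) ?_
    simp [x', AddMonoidAlgebra.one_def, -LaurentPolynomial.single_eq_C_mul_T]
  rw [hu.mul_left_eq_zero, Finsupp.sum, map_sum] at h1
  have h2 := congrArg (fun p => AddMonoidAlgebra.coeff p d) h1
  simp only [map_mul, hcz, hχa _ (ha _), AddMonoidAlgebra.single_mul_single, add_zero,
    AddMonoidAlgebra.coeff_sum, AddMonoidAlgebra.coeff_single, Finsupp.finsetSum_apply,
    Finsupp.single_apply, Finset.sum_ite_eq', AddMonoidAlgebra.coeff_zero, Finsupp.coe_zero,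
    Pi.zero_apply, hc d hd, one_mul] at h2
  split_ifs at h2 with h3
  · exact h2
  · rw [Finsupp.notMem_support_iff.1 h3, map_zero]

end IsQGWA
end QGWA

namespace QGWA

theorem map_mem_sub {k W A : Type*} [Field k] [Ring W] [Algebra k W] [Ring A] [Algebra k A] {m : ℕ}
    {x y : Fin m → W} {t : W} {S : Set (Fin m)} (φ : W →ₐ[k] A) {w : W} (hw : w ∈ sub k x y t S) :
    φ w ∈ sub k (fun i => φ (x i)) (fun i => φ (y i)) (φ t) S :=
  sub_induction (p := fun w => φ w ∈ sub k (fun i => φ (x i)) (fun i => φ (y i)) (φ t) S)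
    t_mem_sub (fun i hi => x_mem_sub (x := fun i => φ (x i)) hi)
    (fun i hi => y_mem_sub (y := fun i => φ (y i)) hi)
    (fun c => by rw [AlgHom.commutes]; exact Subalgebra.algebraMap_mem _ c)
    (fun a b ha hb => by rw [map_add]; exact add_mem ha hb)
    (fun a b ha hb => by rw [map_mul]; exact mul_mem ha hb) hw

namespace IsQGWA
variable {k : Type v} {W : Type u} [Field k] [Ring W] [Algebra k W] {m : ℕ} {q : Fin m → k}
    {h : Fin m → k[X]} {x y : Fin m → W} {t : W} (H : IsQGWA q h x y t)
include H

/-- The left ideal generated by `t` is two-sided, with commutative quotient. -/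
theorem exists_quotient_t (hq : ∀ i, q i ≠ 0) :
    ∃ (Q : Type u) (_ : CommRing Q) (_ : Algebra k Q) (π : W →ₐ[k] Q),
      ∀ w, π w = 0 ↔ ∃ v, w = v * t := by
  have key : ∀ w, (∃ v, w * t = t * v) ∧ ∃ v, t * w = v * t := fun w =>
    H.exists_t_mul hq (H.mem_sub w)
  have htwo : (Ideal.span {t}).IsTwoSided := ⟨fun b ha => by
    obtain ⟨c, rfl⟩ := Ideal.mem_span_singleton'.1 ha
    obtain ⟨v, hv⟩ := (key b).2
    rw [mul_assoc, hv, ← mul_assoc]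
    exact Ideal.mem_span_singleton'.2 ⟨_, rfl⟩⟩
  have hker : ∀ w, Ideal.Quotient.mkₐ k (Ideal.span {t}) w = 0 ↔ ∃ v, w = v * t := fun w => by
    rw [Ideal.Quotient.mkₐ_eq_mk, Ideal.Quotient.eq_zero_iff_mem, Ideal.mem_span_singleton']
    simp only [eq_comm]
  have ht : Ideal.Quotient.mkₐ k (Ideal.span {t}) t = 0 := (hker t).2 ⟨1, (one_mul t).symm⟩
  have hcomm : ∀ a b : W ⧸ Ideal.span {t}, a * b = b * a := fun a b => by
    obtain ⟨v, rfl⟩ := Ideal.Quotient.mkₐ_surjective k _ a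
    obtain ⟨w, rfl⟩ := Ideal.Quotient.mkₐ_surjective k _ b
    have h1 := H.toRel.map (Ideal.Quotient.mkₐ k (Ideal.span {t}))
    have hv := map_mem_sub (Ideal.Quotient.mkₐ k (Ideal.span {t})) (H.mem_sub v)
    have hw := map_mem_sub (Ideal.Quotient.mkₐ k (Ideal.span {t})) (H.mem_sub w)
    rw [ht] at h1 hv hw
    exact h1.commute_of_t_eq_zero hv hw
  let _ : CommRing (W ⧸ Ideal.span {t}) :=
    { (inferInstance : Ring (W ⧸ Ideal.span {t})) with mul_comm := hcomm }
  exact ⟨W ⧸ Ideal.span {t}, inferInstance, inferInstance, Ideal.Quotient.mkₐ k (Ideal.span {t}),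
    hker⟩

theorem map_eq_zero_of_mul {Q : Type u} [CommRing Q] [Algebra k Q] (hq : ∀ i, q i ≠ 0)
    (π : W →ₐ[k] Q) (hπ : ∀ w, π w = 0 ↔ ∃ v, w = v * t) (i : Fin m) {g : W}
    (hx : π (g * x i) = 0) (hy : π (g * y i) = 0) : π g = 0 := by
  have ht : π t = 0 := (hπ t).2 ⟨1, (one_mul t).symm⟩
  obtain ⟨a, ha, rfl⟩ := H.exists_finsupp_hom hq (S := {i}ᶜ) (by simp) (H.mem_sub_insert i g)
  obtain ⟨v, hv⟩ := (hπ _).1 hx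
  obtain ⟨w, hw⟩ := (hπ _).1 hy
  rw [Finsupp.sum, map_sum]
  refine Finset.sum_eq_zero fun d _ => ?_
  rw [map_mul]
  rcases le_total 0 d with hd | hd
  · rw [H.map_component_eq_zero π ht i ha hv hd, mul_zero]
  · have h1 := (H.swap hq).map_component_eq_zero π ht i (a := a.mapDomain (Equiv.neg ℤ))
      (d := -d) (w := w) (fun d => by
        rw [sub_swap, ← neg_neg d, ← Equiv.neg_apply, Finsupp.mapDomain_apply (Equiv.injective _)]
        exact ha _) (by
        rw [Finsupp.sum_mapDomain_index_inj (Equiv.injective _), ← hw]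
        simp only [Equiv.neg_apply, hom_swap]) (by omega)
    rw [← Equiv.neg_apply, Finsupp.mapDomain_apply (Equiv.injective _)] at h1
    rw [h1, mul_zero]

/-- A derivation of `W[X]` over `k` maps `t` into the ideal generated by `t`. -/
theorem exists_derivation_t_eq (hq : ∀ i, q i ≠ 0) {i : Fin m} (hi : q i ≠ 1) {δ : W[X] →+ W[X]}
    (hδ : ∀ f g, δ (f * g) = δ f * g + f * δ g) (hk : ∀ c : k, δ (algebraMap k W[X] c) = 0) :
    ∃ V : W[X], δ (C t) = V * C t := by
  obtain ⟨Q, _, _, π, hπ⟩ := H.exists_quotient_t hq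
  have ht : π t = 0 := (hπ t).2 ⟨1, (one_mul t).symm⟩
  have hsmul : ∀ (c : k) f, δ (c • f) = c • δ f := fun c f => by
    rw [Algebra.smul_def, hδ, hk, zero_mul, zero_add, Algebra.smul_def]
  have key : ∀ (c : k) (z : W), c ≠ 1 → z * t = c • (t * z) →
      ∀ j, π ((δ (C t)).coeff j * z) = 0 := by
    intro c z hc hz j
    have h1 : C z * C t = c • (C t * C z) := by
      rw [← C_mul, hz, ← C_mul, smul_C]
    have h2 := congrArg (fun f => π (coeff f j)) (congrArg δ h1)
    simp only [hδ, hsmul, coeff_add, coeff_mul_C, coeff_C_mul, coeff_smul, map_add, map_mul, ht,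
      map_smul, mul_zero, zero_mul, add_zero, zero_add] at h2
    rw [map_mul]
    have h3 : (1 - c) • (π ((δ (C t)).coeff j) * π z) = 0 := by
      rw [sub_smul, one_smul, ← h2, mul_comm, sub_self]
    exact (smul_eq_zero.1 h3).resolve_left (sub_ne_zero.2 hc.symm)
  have hcoef : ∀ j, ∃ v, (δ (C t)).coeff j = v * t := fun j =>
    (hπ _).1 (H.map_eq_zero_of_mul hq π hπ i (key _ _ hi (H.xt i) j)
      (key _ _ (by simpa using hi) (H.yt i) j))
  choose v hv using hcoef
  refine ⟨∑ j ∈ (δ (C t)).support, monomial j (v j), ?_⟩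
  rw [Finset.sum_mul]
  conv_lhs => rw [as_sum_support (δ (C t))]
  refine Finset.sum_congr rfl fun j _ => ?_
  rw [monomial_mul_C, ← hv]

theorem exists_C_t_pow_mul (hq : ∀ i, q i ≠ 0) (f : W[X]) (n : ℕ) :
    ∃ g : W[X], C t ^ n * f = g * C t ^ n := by
  induction n with
  | zero => exact ⟨f, by simp⟩
  | succ n ih =>
    obtain ⟨g, hg⟩ := ih
    choose v hv using fun w : W => (H.exists_t_mul hq (H.mem_sub w)).2
    refine ⟨∑ j ∈ g.support, monomial j (v (g.coeff j)), ?_⟩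
    have h1 : C t * g = (∑ j ∈ g.support, monomial j (v (g.coeff j))) * C t := by
      rw [Finset.sum_mul]
      conv_lhs => rw [as_sum_support g]
      rw [Finset.mul_sum]
      refine Finset.sum_congr rfl fun j _ => ?_
      rw [monomial_mul_C, C_mul_monomial, hv]
    rw [pow_succ', mul_assoc, hg, ← mul_assoc, h1, mul_assoc]

theorem exists_iterate_derivation_t_pow_eq (hq : ∀ i, q i ≠ 0) {i : Fin m} (hi : q i ≠ 1)
    {δ : W[X] →+ W[X]} (hδ : ∀ f g, δ (f * g) = δ f * g + f * δ g)
    (hk : ∀ c : k, δ (algebraMap k W[X] c) = 0) (N j : ℕ) :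
    ∃ V : W[X], δ^[j] (C (t ^ N)) = V * C (t ^ N) := by
  have h1 : ∀ N, ∃ V : W[X], δ (C t ^ N) = V * C t ^ N := by
    intro N
    induction N with
    | zero => exact ⟨0, by simpa using hk 1⟩
    | succ N ih =>
      obtain ⟨V, hV⟩ := H.exists_derivation_t_eq hq hi hδ hk
      obtain ⟨V', hV'⟩ := ih
      obtain ⟨V'', hV''⟩ := H.exists_C_t_pow_mul hq V N
      refine ⟨V' + V'', ?_⟩
      rw [pow_succ, hδ, hV', hV, ← mul_assoc (C t ^ N), hV'', add_mul, mul_assoc, mul_assoc]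
  obtain ⟨V, hV⟩ := h1 N
  induction j with
  | zero => exact ⟨1, by simp⟩
  | succ j ih =>
    obtain ⟨U, hU⟩ := ih
    refine ⟨δ U + U * V, ?_⟩
    rw [Function.iterate_succ_apply', hU, C_pow, hδ, hV, add_mul, mul_assoc]

end IsQGWA
end QGWA

namespace QGWA

theorem exists_pow_mul_pow_eq_aeval {k W : Type*} [Field k] [Ring W] [Algebra k W] {q : k}
    (hq : q ≠ 0) {x y t : W} {h : k[X]} (hh : h ≠ 0) (hxt : x * t = q • (t * x))
    (hxy : x * y = aeval t h) (n : ℕ) : ∃ P : k[X], P ≠ 0 ∧ x ^ n * y ^ n = aeval t P := by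
  induction n with
  | zero => exact ⟨1, one_ne_zero, by simp⟩
  | succ n ih =>
    obtain ⟨P, hP, hxyP⟩ := ih
    refine ⟨h.comp (C (q ^ n) * X) * P, mul_ne_zero (fun h0 => hh ?_) hP, ?_⟩
    · rw [← comp_one_scale h, ← mul_inv_cancel₀ (pow_ne_zero n hq), ← comp_comp_scale, h0,
        zero_comp]
    · rw [pow_succ, pow_succ', ← mul_assoc, mul_assoc (x ^ n), hxy, pow_mul_aeval_eq hxt, mul_assoc,
        hxyP, map_mul]

theorem isIntegral_aeval {k A W : Type*} [Field k] [CommRing A] [Ring W] [Algebra k W] [Algebra k A]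
    [Algebra A W] [IsScalarTower k A W] {t : W} (ht : IsIntegral A t) (P : k[X]) :
    IsIntegral A (aeval t P) := by
  refine IsIntegral.of_mem_of_fg _ ht.fg_adjoin_singleton _ ?_
  rw [← aeval_map_algebraMap A]
  exact aeval_mem_adjoin_singleton _ _

namespace IsQGWA
variable {k : Type v} {W : Type u} [Field k] [Ring W] [Algebra k W] {m : ℕ} {q : Fin m → k}
    {h : Fin m → k[X]} {x y : Fin m → W} {t : W}
variable {Z : Type*} [CommRing Z] [Algebra k Z] [Algebra Z W] [IsScalarTower k Z W]
  (hinj : Function.Injective (algebraMap Z W))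
include hinj

theorem isIntegral_of_algebraMap_eq_aeval {A : Subalgebra k Z} {T z : Z} (hT : T ∈ A) {N : ℕ}
    (hN : 0 < N) (hTt : algebraMap Z W T = t ^ N) {P : k[X]} (hz : algebraMap Z W z = aeval t P) :
    IsIntegral A z := by
  rw [← isIntegral_algebraMap_iff hinj, hz]
  have : IsScalarTower k A W := IsScalarTower.of_algebraMap_eq fun c => by
    rw [IsScalarTower.algebraMap_apply k Z W]
    rfl
  refine isIntegral_aeval (IsIntegral.of_pow hN ?_) P
  rw [← hTt]
  exact isIntegral_algebraMap (x := (⟨T, hT⟩ : A))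

variable (H : IsQGWA q h x y t)
include H

theorem isIntegral_subalgebra (hq : ∀ i, q i ≠ 0) {n : Fin m → ℕ} (hn : ∀ i, 0 < n i) {N : ℕ}
    (hN : 0 < N) {T : Z} {X Y : Fin m → Z} (hTt : algebraMap Z W T = t ^ N)
    (hX : ∀ i, algebraMap Z W (X i) = x i ^ n i) (hY : ∀ i, algebraMap Z W (Y i) = y i ^ n i)
    {A : Subalgebra k Z} (hTA : T ∈ A) (hXA : ∀ i, X i ∈ A) (hYA : ∀ i, Y i ∈ A) (z : Z) :
    IsIntegral A z := by
  have : IsScalarTower k A W := IsScalarTower.of_algebraMap_eq fun c => by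
    rw [IsScalarTower.algebraMap_apply k Z W]
    rfl
  rw [← isIntegral_algebraMap_iff hinj]
  have : Module.Finite A W := H.toRel.finite hq hn hN ⟨⟨T, hTA⟩, hTt⟩ (fun i => ⟨⟨X i, hXA i⟩,
    hX i⟩)
    (fun i => ⟨⟨Y i, hYA i⟩, hY i⟩) H.gen
  exact Algebra.IsIntegral.isIntegral _

section Derivation
variable [CharZero k] (hWZ : ∀ w : W, IsIntegral Z w) {δ : W[X] →+ W[X]} {Δ : Z[X] →+ Z[X]}
  (hδ : IsLND δ)
  (hδk : ∀ c : k, δ (algebraMap k W[X] c) = 0) (hΔ : IsLND Δ)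
  (hΔk : ∀ c : k, Δ (algebraMap k Z[X] c) = 0)
  (hmap : ∀ v, (Δ v).map (algebraMap Z W) = δ (v.map (algebraMap Z W)))
include hWZ hδ hδk hmap

omit [IsScalarTower k Z W] in
theorem mem_constants_t_pow (hq : ∀ i, q i ≠ 0) {i : Fin m} (hi : q i ≠ 1) {p : Ideal Z}
    (hp : p ∈ minimalPrimes Z) {N : ℕ} {T : Z} (hT : algebraMap Z W T = t ^ N) :
    T ∈ hΔ.constants hΔk p := by
  refine hΔ.mem_constants_of_coeff_mem_radical hΔk hp fun j _ r => ?_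
  have hiter : ∀ j v, (Δ^[j] v).map (algebraMap Z W) = δ^[j] (v.map (algebraMap Z W)) := fun j => by
    induction j with
    | zero => exact fun v => rfl
    | succ j ih => exact fun v => by rw [Function.iterate_succ_apply, ih, hmap]; rfl
  obtain ⟨V, hV⟩ := H.exists_iterate_derivation_t_pow_eq hq hi hδ.leibniz hδk N j
  refine Ideal.radical_mono le_sup_left (mem_radical_span_of_eq_mul hinj (hWZ (V.coeff r)) ?_)
  rw [← coeff_map, hiter, map_C, hT, hV, coeff_mul_C, ← hT, Algebra.commutes]

end Derivation

end IsQGWA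
end QGWA

namespace QGWA

section General
variable {k W : Type*} [Field k] [Ring W] [Algebra k W] {m : ℕ} {q : Fin m → k}
    {h : Fin m → k[X]} {x y : Fin m → W} {t : W}

theorem Rel.commute_mul_of_mem_sub (H : Rel q h x y t) {i : Fin m} (hq : q i ≠ 0) {w : W}
    (hw : w ∈ sub k x y t {i}ᶜ) : ∃ w' ∈ sub k x y t {i}ᶜ, w * x i = x i * w' := by
  refine sub_induction (p := fun w => ∃ w' ∈ sub k x y t {i}ᶜ, w * x i = x i * w') ?_ ?_ ?_ ?_ ?_ ?_
    hw
  · exact ⟨(q i)⁻¹ • t, Subalgebra.smul_mem _ t_mem_sub _, by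
      rw [mul_smul_comm, H.xt, smul_smul, inv_mul_cancel₀ hq, one_smul]⟩
  · exact fun j hj => ⟨x j, x_mem_sub hj, H.xx j i hj⟩
  · exact fun j hj => ⟨y j, y_mem_sub hj, (H.xyc i j (Ne.symm hj)).symm⟩
  · exact fun c => ⟨_, Subalgebra.algebraMap_mem _ c, Algebra.commutes _ _⟩
  · rintro a b ⟨a', ha', ha⟩ ⟨b', hb', hb⟩
    exact ⟨a' + b', add_mem ha' hb', by rw [add_mul, ha, hb, mul_add]⟩
  · rintro a b ⟨a', ha', ha⟩ ⟨b', hb', hb⟩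
    exact ⟨a' * b', mul_mem ha' hb', by rw [mul_assoc, hb, ← mul_assoc, ha, mul_assoc]⟩

theorem Rel.update (H : Rel q h x y t) (i : Fin m) {x' y' : W} (hxt : x' * t = q i • (t * x'))
    (hyt : y' * t = (q i)⁻¹ • (t * y')) (hxy : x' * y' = aeval t (h i))
    (hyx : y' * x' = aeval ((q i)⁻¹ • t) (h i))
    (hc : ∀ j, i ≠ j → Commute x' (x j) ∧ Commute x' (y j) ∧ Commute y' (x j) ∧ Commute y' (y j)) :
    Rel q h (Function.update x i x') (Function.update y i y') t := by
  refine ⟨fun j => ?_, fun j => ?_, fun j => ?_, fun j => ?_, fun j l hjl => ?_, fun j l hjl => ?_,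
    fun j l hjl => ?_⟩
  iterate 4
    rcases eq_or_ne j i with rfl | hj
    · simpa
    · simp only [ne_eq, hj, not_false_eq_true, Function.update_of_ne, H.xt, H.yt, H.xy, H.yx]
  all_goals
    rcases eq_or_ne j i with rfl | hj
    · have := hc l hjl
      simp only [Function.update_self, ne_eq, hjl.symm, not_false_eq_true, Function.update_of_ne,
        this.1.eq, this.2.1.eq, this.2.2.2.eq]
    · rcases eq_or_ne l i with rfl | hl
      · have := hc j hj.symm
        simp only [Function.update_self, ne_eq, hj, not_false_eq_true, Function.update_of_ne,
          this.1.eq, this.2.2.1.eq, this.2.2.2.eq]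
      · simp only [ne_eq, hj, hl, not_false_eq_true, Function.update_of_ne, H.xx j l hjl,
          H.yy j l hjl, H.xyc j l hjl]

end General

open TensorProduct in
/-- Inverting a central element, in the noncommutative setting. -/
theorem exists_localization {k : Type v} {W Z : Type u} [Field k] [Ring W] [Algebra k W]
    [CommRing Z] [Algebra k Z] [Algebra Z W] [IsScalarTower k Z W] (X : Z) :
    ∃ (A : Type u) (_ : Ring A) (_ : Algebra k A) (ι : W →ₐ[k] A) (u : A),
      (∀ w, Commute u (ι w)) ∧ ι (algebraMap Z W X) * u = 1 ∧
        ∀ w, ι w = 0 → ∃ e, w * algebraMap Z W X ^ e = 0 := by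
  refine ⟨Localization.Away X ⊗[Z] W, inferInstance, inferInstance,
    (Algebra.TensorProduct.includeRight : W →ₐ[Z] Localization.Away X ⊗[Z] W).restrictScalars k,
    IsLocalization.Away.invSelf X ⊗ₜ 1, ?_, ?_, ?_⟩
  · intro w
    simp [Commute, SemiconjBy]
  · have : (1 : Localization.Away X) ⊗ₜ[Z] algebraMap Z W X =
        algebraMap Z (Localization.Away X) X ⊗ₜ[Z] (1 : W) := by
      rw [Algebra.algebraMap_eq_smul_one, Algebra.algebraMap_eq_smul_one, TensorProduct.smul_tmul]
    simp only [AlgHom.restrictScalars_apply, Algebra.TensorProduct.includeRight_apply, this,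
      Algebra.TensorProduct.tmul_mul_tmul, IsLocalization.Away.mul_invSelf, mul_one]
    rfl
  · intro w hw
    obtain ⟨⟨s, e, rfl⟩, hs⟩ := (IsLocalizedModule.eq_zero_iff (Submonoid.powers X)
      (TensorProduct.mk Z (Localization.Away X) W 1)).1 hw
    refine ⟨e, ?_⟩
    rw [← map_pow, ← Algebra.commutes, ← Algebra.smul_def]
    exact hs

theorem isNilpotent_coeff_mul {Z : Type*} [CommRing Z] {F : AddMonoidAlgebra Z ℤ} {e : ℤ} {c : Z}
    (hF : IsNilpotent (F * AddMonoidAlgebra.single e c)) (d : ℤ) : IsNilpotent (F.coeff d * c) := by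
  rw [nilpotent_iff_mem_prime]
  intro P hP
  have h1 := hF.map (AddMonoidAlgebra.mapRingHom ℤ (Ideal.Quotient.mk P))
  have h2 := h1.eq_zero
  have h3 := congrArg (fun f => AddMonoidAlgebra.coeff f (d + e)) h2
  simpa only [map_mul, AddMonoidAlgebra.mapRingHom_single, AddMonoidAlgebra.coeff_mul_single_add,
    AddMonoidAlgebra.coeff_mapRingHom, AddMonoidAlgebra.coeff_zero, Finsupp.coe_zero, Pi.zero_apply,
    ← map_mul, Ideal.Quotient.eq_zero_iff_mem] using h3

namespace IsQGWA
variable {k : Type v} {W : Type u} [Field k] [Ring W] [Algebra k W] {m : ℕ} {q : Fin m → k}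
    {h : Fin m → k[X]} {x y : Fin m → W} {t : W} (H : IsQGWA q h x y t)
include H

/-- The grading of `W` by the degree in `x i`. -/
theorem exists_grading (i : Fin m) : ∃ γ : W →ₐ[k] AddMonoidAlgebra W ℤ,
    γ (x i) = AddMonoidAlgebra.single 1 (x i) ∧ γ (y i) = AddMonoidAlgebra.single (-1) (y i) ∧
      ∀ w ∈ sub k x y t {i}ᶜ, γ w = AddMonoidAlgebra.single 0 w := by
  let ι : W →ₐ[k] AddMonoidAlgebra W ℤ := AddMonoidAlgebra.singleZeroAlgHom
  have hι : ∀ w, ι w = AddMonoidAlgebra.single 0 w := fun w => rfl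
  let e : Fin m → ℤ := fun j => if j = i then 1 else 0
  have hrel : Rel q h (fun j => AddMonoidAlgebra.single (e j) (x j))
      (fun j => AddMonoidAlgebra.single (-e j) (y j)) (ι t) := by
    refine ⟨fun j => ?_, fun j => ?_, fun j => ?_, fun j => ?_, fun j l hjl => ?_,
      fun j l hjl => ?_,
      fun j l hjl => ?_⟩
    · rw [hι, AddMonoidAlgebra.single_mul_single, AddMonoidAlgebra.single_mul_single, H.xt,
        add_comm, AddMonoidAlgebra.smul_single]
    · rw [hι, AddMonoidAlgebra.single_mul_single, AddMonoidAlgebra.single_mul_single, H.yt,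
        add_comm, AddMonoidAlgebra.smul_single]
    · rw [aeval_algHom_apply, hι, AddMonoidAlgebra.single_mul_single, H.xy, add_neg_cancel]
    · rw [← map_smul, aeval_algHom_apply, hι, AddMonoidAlgebra.single_mul_single, H.yx,
        neg_add_cancel]
    · rw [AddMonoidAlgebra.single_mul_single, AddMonoidAlgebra.single_mul_single, H.xx j l hjl,
        add_comm]
    · rw [AddMonoidAlgebra.single_mul_single, AddMonoidAlgebra.single_mul_single, H.yy j l hjl,
        add_comm]
    · rw [AddMonoidAlgebra.single_mul_single, AddMonoidAlgebra.single_mul_single, H.xyc j l hjl,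
        add_comm]
  obtain ⟨γ, hx, hy, ht⟩ := H.lift _ _ _ hrel
  refine ⟨γ, ?_, ?_, fun w hw => ?_⟩
  · rw [hx]; simp [e, -LaurentPolynomial.single_eq_C_mul_T]
  · rw [hy]; simp [e, -LaurentPolynomial.single_eq_C_mul_T]
  · rw [← hι]
    refine algHom_eq_of_mem_sub ht (fun j hj => ?_) (fun j hj => ?_) hw
    · have : j ≠ i := hj
      rw [hx, hι]; simp [e, this, -LaurentPolynomial.single_eq_C_mul_T]
    · have : j ≠ i := hj
      rw [hy, hι]; simp [e, this, -LaurentPolynomial.single_eq_C_mul_T]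

/-- If `a` does not involve `x i` and `y i` and is killed by a power of `y i`, then it is killed by
a power of `x i`. -/
theorem exists_mul_pow_eq_zero {Z : Type u} [CommRing Z] [Algebra k Z] [Algebra Z W]
    [IsScalarTower k Z W] (i : Fin m) {n : ℕ} (hn : 0 < n) (hqn : q i ^ n = 1) {X : Z}
    (hX : algebraMap Z W X = x i ^ n) {a : W} (ha : a ∈ sub k x y t {i}ᶜ) {K : ℕ}
    (haY : a * (y i ^ n) ^ K = 0) : ∃ e, a * (x i ^ n) ^ e = 0 := by
  obtain ⟨A, _, _, ι, u, hu, hXu, hι⟩ := exists_localization (k := k) (W := W) X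
  rw [hX] at hXu hι
  have hXc : ∀ w, Commute (ι (x i ^ n)) (ι w) := fun w => by
    rw [← hX]
    exact (show Commute (algebraMap Z W X) w from Algebra.commutes _ _).map ι
  obtain ⟨n, rfl⟩ : ∃ n', n = n' + 1 := ⟨n - 1, by omega⟩
  have hqi : q i ^ n = (q i)⁻¹ := eq_inv_of_mul_eq_one_left (by rw [← pow_succ, hqn])
  have hι1 := H.toRel.map ι
  have hux := hu (x i)
  have huy := hu (y i)
  have hxt := hι1.xt i
  have hxy := hι1.xy i
  have hyx := hι1.yx i
  rw [map_pow] at hXu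
  have hrel := hι1.update i (x' := ι (x i) * ι (y i) * ι (x i)) (y' := u * ι (x i) ^ n) (by
      have h1 : Commute (aeval (ι t) (h i)) (aeval (ι t) Polynomial.X) :=
        (Commute.all (h i) Polynomial.X).map (aeval (ι t))
      rw [aeval_X] at h1
      rw [mul_assoc, hxt, mul_smul_comm, ← mul_assoc, ← mul_assoc, hxy, h1.eq]) (by
      rw [mul_assoc, pow_mul_eq hxt, hqi, mul_smul_comm, ← mul_assoc, (hu t).eq, mul_assoc]) (by
      rw [← hxy, mul_assoc, ← mul_assoc (ι (x i)) u, ← hux.eq, mul_assoc u, ← pow_succ',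
        hux.pow_right _ |>.eq, hXu, mul_one]) (by
      rw [← hyx, mul_assoc u, ← mul_assoc (_ ^ n), ← mul_assoc (_ ^ n), ← pow_succ, ← mul_assoc,
        ← mul_assoc, hux.pow_right _ |>.eq, hXu, one_mul]) (fun j hj =>
      ⟨Commute.mul_left (Commute.mul_left (hι1.xx i j hj) (hι1.xyc j i hj.symm).symm) (hι1.xx i j
        hj),
        Commute.mul_left (Commute.mul_left (hι1.xyc i j hj) (hι1.yy i j hj)) (hι1.xyc i j hj),
        (hu _).mul_left (Commute.pow_left (hι1.xx i j hj) n),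
        (hu _).mul_left (Commute.pow_left (hι1.xyc i j hj) n)⟩)
  obtain ⟨ψ, hψx, hψy, hψt⟩ := H.lift _ _ _ hrel
  have hψa : ψ a = ι a := algHom_eq_of_mem_sub hψt
    (fun j hj => by rw [hψx, Function.update_of_ne hj])
    (fun j hj => by rw [hψy, Function.update_of_ne hj]) ha
  have h1 := congrArg ψ haY
  rw [map_mul, map_pow, map_pow, hψa, hψy, map_zero, Function.update_self] at h1
  have h2 : ι (a * (x i ^ (n + 1)) ^ (n * K)) = 0 := by
    have h3 : u * ι (x i) ^ n * ι (x i) ^ (n + 1) = ι (x i) ^ n := by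
      rw [(hux.pow_right n).eq, mul_assoc, (hux.pow_right (n + 1)).eq, hXu, mul_one]
    have h4 : Commute (u * ι (x i) ^ n) (ι (x i) ^ (n + 1)) :=
      (hux.pow_right _).mul_left (Commute.pow_pow_self _ _ _)
    have h5 : ((u * ι (x i) ^ n) ^ (n + 1)) ^ K * ((ι (x i) ^ (n + 1)) ^ (n + 1)) ^ K =
        (ι (x i) ^ (n + 1)) ^ (n * K) := by
      rw [← ((h4.pow_pow _ _).mul_pow), ← h4.mul_pow, h3, ← pow_mul, ← pow_mul, ← pow_mul]
      congr 1
      ring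
    rw [map_mul, map_pow, map_pow, ← h5, ← mul_assoc, h1, zero_mul]
  obtain ⟨e, he⟩ := hι _ h2
  exact ⟨n * K + e, by rw [pow_add, ← mul_assoc, he]⟩

end IsQGWA
end QGWA

namespace QGWA

section General
variable {k W : Type*} [Field k] [Ring W] [Algebra k W] {m : ℕ} {q : Fin m → k}
    {h : Fin m → k[X]} {x y : Fin m → W} {t : W}

theorem Rel.exists_pow_mul (H : Rel q h x y t) {i : Fin m} (hq : q i ≠ 0) {w : W}
    (hw : w ∈ sub k x y t {i}ᶜ) (d : ℕ) : ∃ w' ∈ sub k x y t {i}ᶜ, w * x i ^ d = x i ^ d * w' := by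
  induction d with
  | zero => exact ⟨w, hw, by simp⟩
  | succ d ih =>
    obtain ⟨w1, hw1, h1⟩ := ih
    obtain ⟨w2, hw2, h2⟩ := H.commute_mul_of_mem_sub hq hw1
    exact ⟨w2, hw2, by rw [pow_succ, ← mul_assoc, h1, mul_assoc, h2, mul_assoc]⟩

theorem Rel.exists_mul_pow (H : Rel q h x y t) {i : Fin m} (hq : q i ≠ 0) {w : W}
    (hw : w ∈ sub k x y t {i}ᶜ) (d l : ℕ) :
    ∃ w' ∈ sub k x y t {i}ᶜ, (x i ^ d * w) ^ l = (x i ^ l) ^ d * w' := by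
  induction l with
  | zero => exact ⟨1, one_mem _, by simp⟩
  | succ l ih =>
    obtain ⟨w1, hw1, h1⟩ := ih
    obtain ⟨w2, hw2, h2⟩ := H.exists_pow_mul hq hw1 d
    refine ⟨w2 * w, mul_mem hw2 hw, ?_⟩
    rw [pow_succ, h1, mul_assoc, ← mul_assoc w1, h2, ← mul_assoc, ← mul_assoc, ← mul_assoc,
      ← pow_mul, ← pow_mul, ← pow_add, add_mul, one_mul]

end General

namespace IsQGWA
variable {k : Type v} {W : Type u} [Field k] [Ring W] [Algebra k W] {m : ℕ} {q : Fin m → k}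
    {h : Fin m → k[X]} {x y : Fin m → W} {t : W} (H : IsQGWA q h x y t)
variable {Z : Type u} [CommRing Z] [Algebra Z W] (hinj : Function.Injective (algebraMap Z W))
include H hinj

/-- Central elements decompose into central homogeneous components. -/
theorem exists_components (hcen : ∀ w : W, (∀ v, v * w = w * v) → ∃ z : Z, algebraMap Z W z = w)
    (hq : ∀ i, q i ≠ 0) (i : Fin m) (z : Z) : ∃ f : AddMonoidAlgebra Z ℤ,
      (z = f.coeff.sum fun _ a => a) ∧
      (∀ d, ∃ a ∈ sub k x y t {i}ᶜ, algebraMap Z W (f.coeff d) = hom (x i) (y i) d * a) ∧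
      ∀ (c : Z), ∀ b ∈ sub k x y t {i}ᶜ, ∀ (l : ℕ), algebraMap Z W c = b * y i ^ l →
        IsNilpotent (z * c) → ∀ d, IsNilpotent (f.coeff d * c) := by
  classical
  obtain ⟨γ, hγx, hγy, hγ⟩ := H.exists_grading i
  obtain ⟨a, ha, hz⟩ := H.exists_finsupp_hom hq (S := {i}ᶜ) (by simp)
    (H.mem_sub_insert i (algebraMap Z W z))
  have hγhom : ∀ d, γ (hom (x i) (y i) d) = AddMonoidAlgebra.single d (hom (x i) (y i) d) := by
    intro d
    obtain ⟨e, rfl | rfl⟩ := d.eq_nat_or_neg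
    · rw [hom_natCast, map_pow, hγx, AddMonoidAlgebra.single_pow, nsmul_eq_mul, mul_one]
    · rw [hom_neg_natCast, map_pow, hγy, AddMonoidAlgebra.single_pow, nsmul_eq_mul, mul_neg_one]
  have hγa : ∀ d, γ (hom (x i) (y i) d * a d) =
      AddMonoidAlgebra.single d (hom (x i) (y i) d * a d) := fun d => by
    rw [map_mul, hγhom, hγ _ (ha d), AddMonoidAlgebra.single_mul_single, add_zero]
  have hγz : ∀ d, (γ (algebraMap Z W z)).coeff d = hom (x i) (y i) d * a d := by
    intro d
    rw [hz, Finsupp.sum, map_sum, AddMonoidAlgebra.coeff_sum, Finsupp.finsetSum_apply]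
    simp only [hγa, AddMonoidAlgebra.coeff_single, Finsupp.single_apply, Finset.sum_ite_eq']
    split_ifs with h0
    · rfl
    · rw [Finsupp.notMem_support_iff.1 h0, mul_zero]
  have hcomm : ∀ (e : ℤ) (v : W), γ v = AddMonoidAlgebra.single e v → ∀ d,
      Commute (hom (x i) (y i) d * a d) v := by
    intro e v hv d
    have h1 := congrArg γ (Algebra.commutes z v)
    rw [map_mul, map_mul, hv] at h1
    have h2 := congrArg (fun f => AddMonoidAlgebra.coeff f (d + e)) h1
    simp only [AddMonoidAlgebra.coeff_mul_single_add, hγz] at h2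
    rw [add_comm, AddMonoidAlgebra.coeff_single_mul_add, hγz] at h2
    exact h2
  have hex : ∀ d, ∃ c : Z, algebraMap Z W c = hom (x i) (y i) d * a d := fun d => by
    refine hcen _ fun v => Eq.symm ?_
    refine commute_of_mem_sub (hcomm 0 t (hγ t t_mem_sub) d) ?_ ?_ (H.mem_sub v)
    · intro j _
      by_cases hj : j = i
      · exact hj ▸ hcomm 1 (x i) hγx d
      · exact hcomm 0 (x j) (hγ _ (x_mem_sub hj)) d
    · intro j _
      by_cases hj : j = i
      · exact hj ▸ hcomm (-1) (y i) hγy d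
      · exact hcomm 0 (y j) (hγ _ (y_mem_sub hj)) d
  choose c hc using hex
  have hc0 : ∀ d, c d ≠ 0 → d ∈ a.support := fun d hd => by
    rw [Finsupp.mem_support_iff]
    rintro h0
    rw [← map_ne_zero_iff _ hinj, hc, h0, mul_zero] at hd
    exact hd rfl
  let f : AddMonoidAlgebra Z ℤ := ⟨Finsupp.onFinset a.support c hc0⟩
  have hfc : ∀ d, f.coeff d = c d := fun d => rfl
  refine ⟨f, ?_, fun d => ⟨a d, ha d, hc d⟩, ?_⟩
  · apply hinj
    rw [Finsupp.onFinset_sum hc0 (fun _ => rfl), map_sum, hz]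
    exact Finset.sum_congr rfl fun d _ => (hc d).symm
  · intro s b hb l hs hnil d
    refine isNilpotent_coeff_mul (e := -l) ?_ d
    obtain ⟨K, hK⟩ := hnil
    refine ⟨K, ?_⟩
    have hσ : Function.Injective (AddMonoidAlgebra.mapRingHom ℤ (algebraMap Z W)) := by
      intro f g hfg
      ext d
      have := congrArg (fun f => AddMonoidAlgebra.coeff f d) hfg
      simp only [AddMonoidAlgebra.coeff_mapRingHom] at this
      exact hinj this
    apply hσ
    have h1 : AddMonoidAlgebra.mapRingHom ℤ (algebraMap Z W) f = γ (algebraMap Z W z) := by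
      ext d
      rw [AddMonoidAlgebra.coeff_mapRingHom, hγz, hfc, hc]
    rw [map_pow, map_mul, AddMonoidAlgebra.mapRingHom_single, h1, map_zero, hs]
    have h2 : AddMonoidAlgebra.single (-l : ℤ) (b * y i ^ l) = γ (b * y i ^ l) := by
      rw [map_mul, map_pow, hγy, hγ b hb, AddMonoidAlgebra.single_pow,
        AddMonoidAlgebra.single_mul_single]
      simp
    rw [h2, ← hs, ← map_mul, ← map_mul, ← map_pow, ← map_pow, hK, map_zero, map_zero]

theorem coeff_mem_radical (hWZ : ∀ w : W, IsIntegral Z w) (hq : ∀ i, q i ≠ 0) {i : Fin m} {n : ℕ}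
    {X : Z} (hX : algebraMap Z W X = x i ^ n) {d : ℕ} (hd : d ≠ 0) {a : W}
    (ha : a ∈ sub k x y t {i}ᶜ) {z : Z} (hz : algebraMap Z W z = x i ^ d * a) :
    z ∈ (Ideal.span {X}).radical := by
  obtain ⟨w, -, hw⟩ := H.toRel.exists_mul_pow (hq i) ha d n
  obtain ⟨d, rfl⟩ := Nat.exists_eq_succ_of_ne_zero hd
  have h1 : z ^ n ∈ (Ideal.span {X}).radical := by
    refine mem_radical_span_of_eq_mul hinj (hWZ (algebraMap Z W X ^ d * w)) ?_
    rw [map_pow, hz, hw, hX, ← mul_assoc, pow_succ']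
  obtain ⟨l, hl⟩ := h1
  exact ⟨n * l, by rwa [pow_mul]⟩

theorem mem_constants_of_mem [CharZero k] [Algebra k Z] [IsScalarTower k Z W]
    (hcen : ∀ w : W, (∀ v, v * w = w * v) → ∃ z : Z, algebraMap Z W z = w)
    (hWZ : ∀ w : W, IsIntegral Z w) {Δ : Z[X] →+ Z[X]} (hΔ : IsLND Δ)
    (hΔk : ∀ c : k, Δ (algebraMap k Z[X] c) = 0) (hq : ∀ i, q i ≠ 0) {i : Fin m} {n : ℕ}
    (hn : 0 < n) (hqn : q i ^ n = 1) {p : Ideal Z} (hp : p ∈ minimalPrimes Z) {X Y g : Z}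
    (hX : algebraMap Z W X = x i ^ n) (hY : algebraMap Z W Y = y i ^ n)
    (hg : algebraMap Z W g ∈ sub k x y t {i}ᶜ) (hgp : g ∉ p) {M : ℕ} (hgM : g * (X * Y) ^ M = 0)
    (hXp : X ∉ p) (hYp : Y ∈ p) : X ∈ hΔ.constants hΔk p := by
  have hpp : p.IsPrime := Ideal.IsMinimalPrime.isPrime hp
  refine hΔ.mem_constants_of_coeff_mem_radical hΔk hp fun j _ r => ?_
  set v := (Δ^[j] (C X)).coeff r
  have hnil : IsNilpotent (v * (g * Y)) := by
    rw [nilpotent_iff_mem_prime]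
    intro P hP
    obtain ⟨p', hp', hle⟩ := Ideal.exists_minimalPrimes_le (bot_le (a := P))
    have hpp' : p'.IsPrime := Ideal.IsMinimalPrime.isPrime hp'
    apply hle
    have h1 : g * (X * Y) ^ M ∈ p' := hgM ▸ p'.zero_mem
    rcases hpp'.mem_or_mem h1 with h2 | h2
    · exact p'.mul_mem_left _ (p'.mul_mem_right _ h2)
    · rcases hpp'.mem_or_mem (hpp'.mem_of_pow_mem _ h2) with h3 | h3
      · have h4 : ∀ j, Δ^[j] (C X) ∈ Ideal.map (C : Z →+* Z[X]) p' := fun j => by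
          induction j with
          | zero => exact Ideal.mem_map_of_mem _ h3
          | succ j ih =>
            rw [Function.iterate_succ_apply']
            exact IsLND.map_mem_map_C_of_minimalPrimes k hΔ hp' _ ih
        exact p'.mul_mem_right _ (Ideal.mem_map_C_iff.1 (h4 j) r)
      · exact p'.mul_mem_left _ (p'.mul_mem_left _ h3)
  obtain ⟨f, hf, hfa, hfn⟩ := H.exists_components hinj hcen hq i v
  have hfn' := hfn (g * Y) _ hg n (by rw [map_mul, hY]) hnil
  rw [hf]
  refine Ideal.sum_mem _ fun d _ => ?_
  obtain ⟨a, ha, had⟩ := hfa d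
  rcases eq_or_ne d 0 with rfl | hd
  · rw [hom_zero, one_mul] at had
    refine Ideal.le_radical (Ideal.mem_sup_right ?_)
    obtain ⟨K, hK⟩ := hfn' 0
    obtain ⟨e, he⟩ := H.exists_mul_pow_eq_zero i hn hqn hX (K := K)
      (pow_mem (mul_mem ha hg) K) (by
        rw [← had, ← hY, ← map_mul, ← map_pow, ← map_pow, ← map_mul, ← mul_pow, mul_assoc, hK,
          map_zero])
    rw [← had, ← hX, ← map_mul, ← map_pow, ← map_pow, ← map_mul,
      map_eq_zero_iff _ hinj] at he
    have h1 : (f.coeff 0 * g) ^ K * X ^ e ∈ p := he ▸ p.zero_mem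
    rcases hpp.mem_or_mem h1 with h2 | h2
    · exact (hpp.mem_or_mem (hpp.mem_of_pow_mem _ h2)).resolve_right hgp
    · exact (hXp (hpp.mem_of_pow_mem _ h2)).elim
  · obtain ⟨e, rfl | rfl⟩ := d.eq_nat_or_neg
    · rw [hom_natCast] at had
      have he : e ≠ 0 := by omega
      exact Ideal.radical_mono le_sup_left (H.coeff_mem_radical hinj hWZ hq hX he ha had)
    · have he : e ≠ 0 := by omega
      rw [hom_neg_natCast] at had
      refine Ideal.radical_mono (le_sup_of_le_right ?_)
        ((H.swap hq).coeff_mem_radical hinj hWZ (fun i => inv_ne_zero (hq i)) hY he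
          (by rwa [sub_swap]) had)
      rwa [Ideal.span_singleton_le_iff_mem]

end IsQGWA
end QGWA

namespace QGWA

/-- The substitution `t ↦ c t`. -/
noncomputable def scale {k : Type*} [Field k] (c : k) : k[X] →ₐ[k] k[X] := aeval (C c * X)

section Scale
variable {k : Type*} [Field k]

theorem scale_apply (c : k) (P : k[X]) : scale c P = P.comp (C c * X) := by
  rw [scale, comp_eq_aeval]

theorem scale_X (c : k) : scale c X = C c * X := by rw [scale, aeval_X]

theorem scale_scale (a b : k) (P : k[X]) : scale a (scale b P) = scale (b * a) P := by
  simp only [scale_apply, comp_comp_scale]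

theorem scale_one (P : k[X]) : scale 1 P = P := by rw [scale_apply, comp_one_scale]

theorem scale_injective {c : k} (hc : c ≠ 0) : Function.Injective (scale c) :=
  Function.LeftInverse.injective (g := scale c⁻¹) fun P => by
    rw [scale_scale, mul_inv_cancel₀ hc, scale_one]

/-- The module on which a quantum generalized Weyl algebra acts. -/
abbrev PolyFun (k : Type*) [Field k] (m : ℕ) : Type _ := (Fin m → ℤ) → k[X]

variable {m : ℕ}

/-- The action of `t`. -/
noncomputable def tEnd : Module.End k (PolyFun k m) where
  toFun F b := X * F b
  map_add' F G := funext fun b => mul_add X (F b) (G b)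
  map_smul' c F := funext fun b => mul_smul_comm c X (F b)

/-- The action of `x i`. -/
noncomputable def xEnd (q : Fin m → k) (i : Fin m) : Module.End k (PolyFun k m) where
  toFun F b := scale (q i) (F (b - Pi.single i 1))
  map_add' F G := funext fun b => by simp only [Pi.add_apply, map_add]
  map_smul' c F := funext fun b => by simp only [Pi.smul_apply, map_smul, RingHom.id_apply]

/-- The action of `y i`. -/
noncomputable def yEnd (q : Fin m → k) (h : Fin m → k[X]) (i : Fin m) :
    Module.End k (PolyFun k m) where
  toFun F b := scale (q i)⁻¹ (h i * F (b + Pi.single i 1))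
  map_add' F G := funext fun b => by simp only [Pi.add_apply, mul_add, map_add]
  map_smul' c F := funext fun b => by
    simp only [Pi.smul_apply, mul_smul_comm, map_smul, RingHom.id_apply]

theorem tEnd_apply (F : PolyFun k m) (b : Fin m → ℤ) : tEnd F b = X * F b := rfl

theorem xEnd_apply (q : Fin m → k) (i : Fin m) (F : PolyFun k m) (b : Fin m → ℤ) :
    xEnd q i F b = scale (q i) (F (b - Pi.single i 1)) := rfl

theorem yEnd_apply (q : Fin m → k) (h : Fin m → k[X]) (i : Fin m) (F : PolyFun k m)
    (b : Fin m → ℤ) : yEnd q h i F b = scale (q i)⁻¹ (h i * F (b + Pi.single i 1)) := rfl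

theorem aeval_tEnd (P : k[X]) (F : PolyFun k m) (b : Fin m → ℤ) :
    aeval (tEnd : Module.End k (PolyFun k m)) P F b = P * F b := by
  induction P using Polynomial.induction_on generalizing b with
  | C a => simp [Module.algebraMap_end_apply, ← smul_eq_C_mul]
  | add P Q hP hQ => simp [hP, hQ, add_mul]
  | monomial n a ih =>
    rw [pow_succ', mul_left_comm, map_mul, aeval_X, Module.End.mul_apply, mul_assoc, ← ih]
    rfl

variable {q : Fin m → k} {h : Fin m → k[X]}

theorem rel_end (hq : ∀ i, q i ≠ 0) (hh : ∀ i j, i ≠ j → scale (q i) (h j) = h j) :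
    Rel q h (xEnd q) (yEnd q h) (tEnd : Module.End k (PolyFun k m)) := by
  have hh' : ∀ i j, i ≠ j → scale (q i)⁻¹ (h j) = h j := fun i j hij => by
    apply scale_injective (hq i)
    rw [scale_scale, inv_mul_cancel₀ (hq i), scale_one, hh i j hij]
  refine ⟨fun i => ?_, fun i => ?_, fun i => ?_, fun i => ?_, fun i j hij => ?_, fun i j hij => ?_,
    fun i j hij => ?_⟩
  all_goals refine LinearMap.ext fun F => funext fun b => ?_
  · simp only [Module.End.mul_apply, LinearMap.smul_apply, Pi.smul_apply, xEnd_apply, tEnd_apply]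
    rw [map_mul, scale_X, smul_eq_C_mul, mul_assoc]
  · simp only [Module.End.mul_apply, LinearMap.smul_apply, Pi.smul_apply, yEnd_apply, tEnd_apply]
    rw [map_mul, map_mul, map_mul, scale_X, smul_eq_C_mul]
    ring
  · rw [aeval_tEnd, Module.End.mul_apply, xEnd_apply, yEnd_apply, scale_scale,
      inv_mul_cancel₀ (hq i), scale_one, sub_add_cancel]
  · rw [aeval_smul_eq, aeval_tEnd, Module.End.mul_apply, yEnd_apply, xEnd_apply, map_mul,
      scale_scale, mul_inv_cancel₀ (hq i), scale_one, add_sub_cancel_right, scale_apply]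
  · simp only [Module.End.mul_apply, xEnd_apply]
    rw [scale_scale, scale_scale, mul_comm, sub_right_comm]
  · have h1 : scale ((q j)⁻¹ * (q i)⁻¹) (h j) = scale (q j)⁻¹ (h j) := by
      rw [mul_comm, ← scale_scale, hh' i j hij]
    have h2 : scale ((q j)⁻¹ * (q i)⁻¹) (h i) = scale (q i)⁻¹ (h i) := by
      rw [← scale_scale, hh' j i hij.symm]
    simp only [Module.End.mul_apply, yEnd_apply, map_mul, scale_scale, mul_comm (q i)⁻¹ (q j)⁻¹]
    rw [add_right_comm, h1, h2, mul_left_comm]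
  · simp only [Module.End.mul_apply, yEnd_apply, xEnd_apply, map_mul]
    rw [scale_scale (q i), scale_scale (q i), scale_scale (q j)⁻¹, mul_comm (q j)⁻¹,
      ← scale_scale (q j)⁻¹, hh i j hij,
      sub_add_eq_add_sub]

end Scale

namespace IsQGWA
variable {k W : Type u} [Field k] [Ring W] [Algebra k W] {m : ℕ} {q : Fin m → k}
    {h : Fin m → k[X]} {x y : Fin m → W} {t : W} (H : IsQGWA q h x y t)
include H

theorem eq_zero_of_aeval_mul (hq : ∀ i, q i ≠ 0) (hh0 : ∀ i, h i ≠ 0)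
    (hh : ∀ i j, i ≠ j → scale (q i) (h j) = h j) {P : k[X]} (hP : P ≠ 0) {w : W}
    (hw : aeval t P * w = 0) : w = 0 := by
  classical
  obtain ⟨ρ, hx, hy, ht⟩ := H.lift _ _ _ (rel_end hq hh)
  have hxc : ∀ i (F : PolyFun k m) c, (∀ b : Fin m → ℤ, b i ≠ c → F b = 0) →
      ∀ b : Fin m → ℤ, b i ≠ c + 1 → ρ (x i) F b = 0 := fun i F c hF b hb => by
    rw [hx]
    rw [xEnd_apply, hF, map_zero]
    simpa [sub_eq_iff_eq_add] using hb
  have hyc : ∀ i (F : PolyFun k m) c, (∀ b : Fin m → ℤ, b i ≠ c → F b = 0) →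
      ∀ b : Fin m → ℤ, b i ≠ c - 1 → ρ (y i) F b = 0 := fun i F c hF b hb => by
    rw [hy]
    rw [yEnd_apply, hF, mul_zero, map_zero]
    simpa [eq_sub_iff_add_eq] using hb
  have hhomc : ∀ i (F : PolyFun k m), (∀ b : Fin m → ℤ, b i ≠ 0 → F b = 0) → ∀ (d : ℤ),
      ∀ b : Fin m → ℤ, b i ≠ d → ρ (hom (x i) (y i) d) F b = 0 := fun i F hF d => by
    obtain ⟨e, rfl | rfl⟩ := d.eq_nat_or_neg
    · rw [hom_natCast]
      induction e with
      | zero => simpa using hF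
      | succ e ih =>
        rw [pow_succ', map_mul]
        push_cast
        exact hxc i _ _ ih
    · rw [hom_neg_natCast]
      induction e with
      | zero => simpa using hF
      | succ e ih =>
        rw [pow_succ', map_mul]
        push_cast
        rw [neg_add]
        exact hyc i _ _ ih
  have hsubc : ∀ i, ∀ a ∈ sub k x y t {i}ᶜ, ∀ F : PolyFun k m,
      (∀ b : Fin m → ℤ, b i ≠ 0 → F b = 0) → ∀ b : Fin m → ℤ, b i ≠ 0 → ρ a F b = 0 := by
    intro i a ha
    refine sub_induction (p := fun a => ∀ F : PolyFun k m,
      (∀ b : Fin m → ℤ, b i ≠ 0 → F b = 0) → ∀ b : Fin m → ℤ, b i ≠ 0 → ρ a F b = 0)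
      ?_ ?_ ?_ ?_ ?_ ?_ ha
    · intro F hF b hb
      rw [ht]
      rw [tEnd_apply, hF b hb, mul_zero]
    · intro j hj F hF b hb
      have hij : i ≠ j := Ne.symm hj
      rw [hx]
      rw [xEnd_apply, hF, map_zero]
      simpa [hij] using hb
    · intro j hj F hF b hb
      have hij : i ≠ j := Ne.symm hj
      rw [hy]
      rw [yEnd_apply, hF, mul_zero, map_zero]
      simpa [hij] using hb
    · intro c F hF b hb
      rw [AlgHom.commutes, Module.algebraMap_end_apply, Pi.smul_apply, hF b hb, smul_zero]
    · intro a b ha hb F hF c hc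
      rw [map_add, LinearMap.add_apply, Pi.add_apply, ha F hF c hc, hb F hF c hc, add_zero]
    · intro a b ha hb F hF c hc
      rw [map_mul, Module.End.mul_apply, ha _ (hb F hF) c hc]
  have hxinj : ∀ i (F : PolyFun k m), ρ (x i) F = 0 → F = 0 := fun i F hF => by
    rw [hx] at hF
    funext b
    have h1 : scale (q i) (F (b + Pi.single i 1 - Pi.single i 1)) = 0 := congrFun hF _
    rw [add_sub_cancel_right] at h1
    exact (map_eq_zero_iff _ (scale_injective (hq i))).1 h1
  have hyinj : ∀ i (F : PolyFun k m), ρ (y i) F = 0 → F = 0 := fun i F hF => by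
    rw [hy] at hF
    funext b
    have h1 : scale (q i)⁻¹ (h i * F (b - Pi.single i 1 + Pi.single i 1)) = 0 := congrFun hF _
    rw [sub_add_cancel] at h1
    exact (mul_eq_zero.1 ((map_eq_zero_iff _ (scale_injective (inv_ne_zero (hq i)))).1
      h1)).resolve_left
      (hh0 i)
  have hpow : ∀ (z : W), (∀ F, ρ z F = 0 → F = 0) → ∀ (e : ℕ) F, ρ (z ^ e) F = 0 → F = 0 := by
    intro z hz e
    induction e with
    | zero => simp
    | succ e ih =>
      intro F hF
      rw [pow_succ', map_mul, Module.End.mul_apply] at hF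
      exact ih _ (hz _ hF)
  have hhominj : ∀ i (d : ℤ) (F : PolyFun k m), ρ (hom (x i) (y i) d) F = 0 → F = 0 := by
    intro i d
    obtain ⟨e, rfl | rfl⟩ := d.eq_nat_or_neg
    · rw [hom_natCast]; exact hpow _ (hxinj i) e
    · rw [hom_neg_natCast]; exact hpow _ (hyinj i) e
  have hinj : ∀ S : Finset (Fin m), ∀ w ∈ sub k x y t S,
      ρ w (Pi.single 0 1 : PolyFun k m) = 0 → w = 0 := by
    intro S
    induction S using Finset.induction_on with
    | empty =>
      intro w hw h0
      rw [sub] at hw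
      simp only [Finset.coe_empty, Set.image_empty, Set.union_empty, insert_empty_eq] at hw
      rw [Algebra.adjoin_singleton_eq_range_aeval] at hw
      obtain ⟨P, rfl⟩ := hw
      rw [AlgHom.toRingHom_eq_coe, RingHom.coe_coe] at h0 ⊢
      rw [← aeval_algHom_apply, ht] at h0
      have h1 := congrFun h0 0
      rw [aeval_tEnd, Pi.single_eq_same, mul_one] at h1
      rw [h1]
      exact map_zero _
    | insert i S hi ih =>
      intro w hw h0
      rw [Finset.coe_insert] at hw
      obtain ⟨a, ha, rfl⟩ := H.exists_finsupp_hom hq (by simpa using hi) hw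
      have hS : (S : Set (Fin m)) ⊆ {i}ᶜ := fun j hj hji => hi (hji ▸ hj)
      have hsub : sub k x y t S ≤ sub k x y t {i}ᶜ := Algebra.adjoin_mono
        (Set.insert_subset_insert (Set.union_subset_union (Set.image_mono hS) (Set.image_mono hS)))
      have hconc : ∀ d, ∀ b : Fin m → ℤ, b i ≠ d →
          ρ (hom (x i) (y i) d * a d) (Pi.single 0 1 : PolyFun k m) b = 0 := fun d => by
        rw [map_mul]
        refine hhomc i _ (hsubc i _ (hsub (ha d)) _ fun b hb => ?_) d
        rw [Pi.single_eq_of_ne]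
        rintro rfl
        exact hb rfl
      refine Finset.sum_eq_zero fun d hd => ?_
      have h1 : ρ (hom (x i) (y i) d * a d) (Pi.single 0 1 : PolyFun k m) = 0 := by
        funext b
        by_cases hb : b i = d
        · have h2 := congrFun h0 b
          rw [Finsupp.sum, map_sum, LinearMap.sum_apply, Finset.sum_apply,
            Finset.sum_eq_single d] at h2
          · exact h2
          · intro d' _ hd'
            exact hconc d' b (hb ▸ hd'.symm)
          · exact fun h3 => (h3 hd).elim
        · exact hconc d b hb
      rw [map_mul] at h1
      show hom (x i) (y i) d * a d = 0
      rw [ih _ (ha d) (hhominj i d _ h1), mul_zero]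
  refine hinj Finset.univ w (by rw [Finset.coe_univ]; exact H.mem_sub w) (funext fun b => ?_)
  have h1 := congrArg (fun a => ρ a (Pi.single 0 1 : PolyFun k m) b) hw
  simp only [map_mul, ← aeval_algHom_apply, ht, Module.End.mul_apply, aeval_tEnd] at h1
  rw [map_zero] at h1
  exact (mul_eq_zero.1 h1).resolve_left hP

end IsQGWA
end QGWA

namespace QGWA

theorem Rel.isIntegral_of_scale_ne {k W : Type*} [Field k] [Ring W] [Algebra k W] {m : ℕ}
    {q : Fin m → k} {h : Fin m → k[X]} {x y : Fin m → W} {t : W} (H : Rel q h x y t)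
    (hh0 : ∀ i, h i ≠ 0) {i j : Fin m} (hij : i ≠ j) (hs : scale (q i) (h j) ≠ h j) :
    IsIntegral k t := by
  have h1 : x i * aeval t (h j) = aeval t (h j) * x i := by
    rw [← H.xy j, ← mul_assoc, H.xx i j hij, mul_assoc, H.xyc i j hij, mul_assoc]
  have h2 : aeval t ((scale (q i) (h j) - h j) * h i) = 0 := by
    rw [map_mul, ← H.xy i, ← mul_assoc, map_sub, sub_mul, scale_apply, ← mul_aeval_eq (H.xt i), h1,
      sub_self, zero_mul]
  exact isAlgebraic_iff_isIntegral.1 ⟨_, mul_ne_zero (sub_ne_zero.2 hs) (hh0 i), h2⟩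

theorem exists_pow_mul_eq_zero_of_isIntegral {k Z : Type*} [Field k] [CommRing Z] [Algebra k Z]
    {z : Z}
    (hz : IsIntegral k z) : ∃ r : k[X], r.coeff 0 ≠ 0 ∧ ∃ M, aeval z r * z ^ M = 0 := by
  obtain ⟨G, hG, hGz⟩ := hz
  obtain ⟨r, hr, hXr⟩ := exists_eq_pow_rootMultiplicity_mul_and_not_dvd G hG.ne_zero 0
  rw [C_0, sub_zero] at hr hXr
  refine ⟨r, fun h0 => hXr (X_dvd_iff.2 h0), G.rootMultiplicity 0, ?_⟩
  have h1 : aeval z G = 0 := hGz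
  rw [hr, map_mul, map_pow, aeval_X, mul_comm] at h1
  exact h1

theorem aeval_notMem {k Z : Type*} [Field k] [CommRing Z] [Algebra k Z] {z : Z} {p : Ideal Z}
    (hp : p ≠ ⊤) (hz : z ∈ p) {r : k[X]} (hr : r.coeff 0 ≠ 0) : aeval z r ∉ p := fun h => by
  rw [← divX_mul_X_add r, map_add, map_mul, aeval_X, aeval_C] at h
  have h1 := (p.add_mem_iff_right (p.mul_mem_left _ hz)).1 h
  exact hp (p.eq_top_of_isUnit_mem h1 ((isUnit_iff_ne_zero.2 hr).map (algebraMap k Z)))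

namespace IsQGWA
variable {k W : Type u} [Field k] [Ring W] [Algebra k W] {m : ℕ} {q : Fin m → k}
    {h : Fin m → k[X]} {x y : Fin m → W} {t : W} (H : IsQGWA q h x y t)
    {Z : Type u} [CommRing Z] [Algebra k Z] [Algebra Z W] [IsScalarTower k Z W]
    (hinj : Function.Injective (algebraMap Z W))
include H hinj

theorem exists_mem_sub_mul_pow_eq_zero (hq : ∀ i, q i ≠ 0) (hh0 : ∀ i, h i ≠ 0) {i : Fin m} {n : ℕ}
    {p : Ideal Z} (hp : p ∈ minimalPrimes Z) {X Y : Z} (hX : algebraMap Z W X = x i ^ n)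
    (hY : algebraMap Z W Y = y i ^ n) (hXY : X * Y ∈ p) :
    ∃ g ∉ p, algebraMap Z W g ∈ sub k x y t {i}ᶜ ∧ ∃ M, g * (X * Y) ^ M = 0 := by
  obtain ⟨P, hP, hxyP⟩ := exists_pow_mul_pow_eq_aeval (hq i) (hh0 i) (H.xt i) (H.xy i) n
  have hXYP : algebraMap Z W (X * Y) = aeval t P := by rw [map_mul, hX, hY, hxyP]
  by_cases hs : ∀ i j, i ≠ j → scale (q i) (h j) = h j
  · obtain ⟨g, hg, K, hgK⟩ := IsLND.exists_mul_pow_eq_zero_of_mem_minimalPrimes hp hXY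
    refine absurd ?_ hg
    have h1 : aeval t (P ^ K) * algebraMap Z W g = 0 := by
      rw [map_pow, ← hXYP, ← map_pow, ← map_mul, mul_comm, hgK, map_zero]
    have h2 := H.eq_zero_of_aeval_mul hq hh0 hs (pow_ne_zero K hP) h1
    rw [hinj (h2.trans (map_zero _).symm)]
    exact zero_mem p
  · push Not at hs
    obtain ⟨i', j, hij, hs⟩ := hs
    have h1 : IsIntegral k (algebraMap Z W (X * Y)) :=
      hXYP ▸ isIntegral_aeval (H.toRel.isIntegral_of_scale_ne hh0 hij hs) P
    obtain ⟨r, hr, M, hM⟩ := exists_pow_mul_eq_zero_of_isIntegral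
      ((isIntegral_algebraMap_iff hinj).1 h1)
    refine ⟨aeval (X * Y) r, aeval_notMem (Ideal.IsMinimalPrime.isPrime hp).ne_top hXY hr, ?_, M,
      hM⟩
    rw [← aeval_algebraMap_apply, hXYP, ← aeval_comp]
    exact aeval_mem_sub _

end IsQGWA
end QGWA

namespace QGWA.IsQGWA
variable {k W : Type u} [Field k] [CharZero k] [Ring W] [Algebra k W] {m : ℕ} {q : Fin m → k}
    {h : Fin m → k[X]} {x y : Fin m → W} {t : W} (H : IsQGWA q h x y t)
    {Z : Type u} [CommRing Z] [Algebra k Z] [Algebra Z W] [IsScalarTower k Z W]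
    (hinj : Function.Injective (algebraMap Z W))
    (hcen : ∀ w : W, (∀ v, v * w = w * v) → ∃ z : Z, algebraMap Z W z = w)
include H hinj hcen

theorem mem_constants_x_y_pow (hWZ : ∀ w : W, IsIntegral Z w) {Δ : Z[X] →+ Z[X]} (hΔ : IsLND Δ)
    (hΔk : ∀ c : k, Δ (algebraMap k Z[X] c) = 0) (hq : ∀ i, q i ≠ 0) (hh0 : ∀ i, h i ≠ 0)
    {i : Fin m} {n : ℕ} (hn : 0 < n) (hqn : q i ^ n = 1) {p : Ideal Z} (hp : p ∈ minimalPrimes Z)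
    {X Y T : Z} (hX : algebraMap Z W X = x i ^ n) (hY : algebraMap Z W Y = y i ^ n) {N : ℕ}
    (hN : 0 < N) (hT : algebraMap Z W T = t ^ N) (hTp : T ∈ hΔ.constants hΔk p) :
    X ∈ hΔ.constants hΔk p ∧ Y ∈ hΔ.constants hΔk p := by
  have hmem : ∀ z ∈ p, z ∈ hΔ.constants hΔk p := fun z hz =>
    IsLND.map_mem_map_C_of_minimalPrimes k hΔ hp _ (Ideal.mem_map_of_mem C hz)
  obtain ⟨P, -, hxyP⟩ := exists_pow_mul_pow_eq_aeval (hq i) (hh0 i) (H.xt i) (H.xy i) n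
  have hXYP : algebraMap Z W (X * Y) = aeval t P := by rw [map_mul, hX, hY, hxyP]
  have hXYc : X * Y ∈ hΔ.constants hΔk p := IsLND.mem_constants_of_isIntegral hΔ hΔk hp
    (isIntegral_of_algebraMap_eq_aeval hinj hTp hN hT hXYP)
  by_cases hXY : X * Y ∈ p
  · obtain ⟨g, hgp, hg, M, hgM⟩ := H.exists_mem_sub_mul_pow_eq_zero hinj hq hh0 hp hX hY hXY
    rcases (Ideal.IsMinimalPrime.isPrime hp).mem_or_mem hXY with hXp | hYp
    · refine ⟨hmem X hXp, ?_⟩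
      by_cases hYp : Y ∈ p
      · exact hmem Y hYp
      · refine (H.swap hq).mem_constants_of_mem hinj hcen hWZ hΔ hΔk (fun j => inv_ne_zero (hq j))
          hn
          (by rw [inv_pow, hqn, inv_one]) hp hY hX (g := g) ?_ hgp (M := M) ?_ hYp hXp
        · rwa [sub_swap]
        · rwa [mul_comm Y]
    · refine ⟨?_, hmem Y hYp⟩
      by_cases hXp : X ∈ p
      · exact hmem X hXp
      · exact H.mem_constants_of_mem hinj hcen hWZ hΔ hΔk hq hn hqn hp hX hY hg hgp hgM hXp hYp
  · exact ⟨IsLND.mem_constants_of_mul hΔ hΔk hp hXY hXYc,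
      IsLND.mem_constants_of_mul hΔ hΔk hp (mul_comm X Y ▸ hXY) (mul_comm X Y ▸ hXYc)⟩

theorem nonempty_algEquiv (hq : ∀ i, q i ≠ 0) (hh0 : ∀ i, h i ≠ 0) {n : Fin m → ℕ}
    (hn : ∀ i, 0 < n i) (hqn : ∀ i, q i ^ n i = 1) {i₀ : Fin m} (hi₀ : q i₀ ≠ 1)
    {B : Type*} [Ring B] [Algebra k B] (φ : W[X] ≃ₐ[k] B[X]) : Nonempty (W ≃ₐ[k] B) := by
  have hN : 0 < ∏ i, n i := Finset.prod_pos fun i _ => hn i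
  have hqN : ∀ i, q i ^ (∏ i, n i) = 1 := fun i => by
    obtain ⟨c, hc⟩ := Finset.dvd_prod_of_mem n (Finset.mem_univ i)
    rw [hc, pow_mul, hqn, one_pow]
  obtain ⟨T, hT⟩ := hcen (t ^ ∏ i, n i) fun v => (H.tpow_commute hqN (H.mem_sub v)).eq.symm
  choose X hX using fun i => hcen (x i ^ n i) fun v => (H.xpow_commute hqn i (H.mem_sub v)).eq.symm
  choose Y hY using fun i => hcen (y i ^ n i) fun v =>
    (H.ypow_commute hq hqn i (H.mem_sub v)).eq.symm
  have hfin : Module.Finite Z W := H.toRel.finite hq hn hN ⟨T, hT⟩ (fun i => ⟨X i, hX i⟩)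
    (fun i => ⟨Y i, hY i⟩) H.gen
  have hWZ : ∀ w : W, IsIntegral Z w := fun w => IsIntegral.of_finite Z w
  obtain ⟨δ, Δ, f, hδ, hΔ, hmap, hδk, hΔk, hφ, hf⟩ := exists_center_derivation hinj hcen φ
  obtain ⟨h1, h2⟩ := isUnit_and_isNilpotent_of_forall_minimalPrimes (f := f) fun p hp => by
    have hTc := H.mem_constants_t_pow hinj hWZ hδ hδk hΔ hΔk hmap hq hi₀ hp hT
    have hXY := fun i => H.mem_constants_x_y_pow hinj hcen hWZ hΔ hΔk hq hh0 (hn i) (hqn i) hp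
      (hX i) (hY i) hN hT hTc
    exact IsLND.coeff_of_constants_eq_top hΔ hΔk hp (fun z =>
      IsLND.mem_constants_of_isIntegral hΔ hΔk hp (H.isIntegral_subalgebra hinj hq hn hN hT hX hY
        hTc
        (fun i => (hXY i).1) (fun i => (hXY i).2) z)) hf
  exact nonempty_algEquiv_of_map_eq_X φ hφ h1 h2

end QGWA.IsQGWA

namespace QGWA

/-- The degree for the lexicographic order of the leading monomial. -/
noncomputable def lexDegree {k : Type*} [Field k] (P : k[X][X]) : ℕ :=
  P.natDegree + P.leadingCoeff.natDegree

section LexDegree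
variable {k : Type*} [Field k]

theorem lexDegree_mul {P Q : k[X][X]} (hP : P ≠ 0) (hQ : Q ≠ 0) :
    lexDegree (P * Q) = lexDegree P + lexDegree Q := by
  simp only [lexDegree]
  rw [natDegree_mul hP hQ, leadingCoeff_mul, natDegree_mul (leadingCoeff_ne_zero.2 hP)
    (leadingCoeff_ne_zero.2 hQ), add_add_add_comm]

theorem lexDegree_sub_algebraMap (P : k[X][X]) (c : k) :
    lexDegree (P - algebraMap k k[X][X] c) = lexDegree P := by
  rw [IsScalarTower.algebraMap_apply k k[X] k[X][X], algebraMap_eq, algebraMap_eq]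
  simp only [lexDegree]
  rw [natDegree_sub_C]
  rcases Nat.eq_zero_or_pos P.natDegree with h0 | h0
  · rw [eq_C_of_natDegree_eq_zero h0, ← C_sub, leadingCoeff_C, leadingCoeff_C, natDegree_sub_C]
  · rw [leadingCoeff_sub_of_degree_lt]
    exact degree_C_le.trans_lt (natDegree_pos_iff_degree_pos.1 h0)

theorem eq_algebraMap_of_lexDegree_eq_zero {P : k[X][X]} (h : lexDegree P = 0) :
    ∃ c, P = algebraMap k k[X][X] c := by
  obtain ⟨h0, h1⟩ := Nat.add_eq_zero_iff.1 h
  rw [eq_C_of_natDegree_eq_zero h0, leadingCoeff_C] at h1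
  refine ⟨(P.coeff 0).coeff 0, ?_⟩
  rw [IsScalarTower.algebraMap_apply k k[X] k[X][X], algebraMap_eq, algebraMap_eq,
    ← eq_C_of_natDegree_eq_zero h1, ← eq_C_of_natDegree_eq_zero h0]

end LexDegree

section Cancel
variable {k : Type u} {B : Type v} [Field k] [CommRing B] [Algebra k B]

theorem trdeg_eq_one_of_algEquiv [IsDomain B] (φ : B[X] ≃ₐ[k] k[X][X]) : Algebra.trdeg k B = 1 := by
  have h1 := φ.lift_trdeg_eq
  rw [← trdeg_add_eq k k[X] (A := k[X][X]), ← trdeg_add_eq k B (A := B[X]),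
    Polynomial.trdeg_of_isDomain,
    Polynomial.trdeg_of_isDomain, Polynomial.trdeg_of_isDomain] at h1
  simp only [Cardinal.lift_add, Cardinal.lift_one] at h1
  rw [← Cardinal.lift_eq_one]
  exact Cardinal.add_one_inj.1 h1

theorem exists_dvd_aeval [IsDomain B] (h1 : Algebra.trdeg k B = 1) {a : B} (ha : a ≠ 0) (b : B) :
    ∃ g : k[X], g ≠ 0 ∧ a ∣ aeval b g := by
  by_cases hb : IsAlgebraic k b
  · obtain ⟨g, hg, hgb⟩ := hb
    exact ⟨g, hg, hgb ▸ dvd_zero a⟩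
  · have hb' : AlgebraicIndependent k (fun _ : Unit => b) :=
      algebraicIndependent_unique_type_iff.2 hb
    have h2 := hb'.isTranscendenceBasis_of_lift_trdeg_le_of_finite (by simp [h1])
    have h3 := h2.isAlgebraic
    obtain ⟨⟨r, hr⟩, hr0, hra⟩ := (h3.isAlgebraic a).exists_nonzero_dvd
      (mem_nonZeroDivisors_of_ne_zero ha)
    rw [Set.range_const, Algebra.adjoin_singleton_eq_range_aeval] at hr
    obtain ⟨g, hg⟩ := hr
    refine ⟨g, ?_, ?_⟩
    · rintro rfl
      exact hr0 (Subtype.ext (hg.symm.trans (map_zero _)))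
    · exact hra.trans (dvd_of_eq hg.symm)

end Cancel
end QGWA

namespace QGWA

section Cancel
variable {k : Type u} {B : Type v} [Field k] [CommRing B] [Algebra k B]

theorem exists_prime_mem_ker [IsDomain B] [UniqueFactorizationMonoid B[X]] (ε : B[X] →ₐ[k] k)
    (h1 : Algebra.trdeg k B = 1) : ∃ π : B, Prime π ∧ ε (C π) = 0 := by
  obtain ⟨b, hb0, hb⟩ : ∃ b : B, b ≠ 0 ∧ ε (C b) = 0 := by
    by_contra! h
    have halg : Algebra.IsAlgebraic k B := ⟨fun b => by
      have h2 : b - algebraMap k B (ε (C b)) = 0 := by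
        by_contra h3
        refine h _ h3 ?_
        rw [C_sub, map_sub, ← Polynomial.algebraMap_apply, AlgHom.commutes, sub_eq_zero]
        rfl
      rw [sub_eq_zero.1 h2]
      exact isAlgebraic_algebraMap _⟩
    rw [trdeg_eq_zero] at h1
    exact zero_ne_one h1
  obtain ⟨f, hf, hfb⟩ := UniqueFactorizationMonoid.exists_prime_factors (C b) (C_ne_zero.2 hb0)
  have hprime : (RingHom.ker ε).IsPrime := RingHom.ker_isPrime ε
  have hmem : f.prod ∈ RingHom.ker ε := by
    obtain ⟨c, hc⟩ := hfb.symm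
    rw [← hc]
    exact Ideal.mul_mem_right _ _ hb
  obtain ⟨P, hP, hPε⟩ := (hprime.multiset_prod_mem_iff_exists_mem f).1 hmem
  obtain ⟨c, hc⟩ := (Multiset.dvd_prod hP).trans hfb.dvd
  have hdeg : P.natDegree = 0 := by
    have h2 := congrArg natDegree hc
    rw [natDegree_C, natDegree_mul (hf P hP).ne_zero
      (right_ne_zero_of_mul (hc ▸ C_ne_zero.2 hb0))] at h2
    omega
  refine ⟨P.coeff 0, ?_, ?_⟩
  · rw [← prime_C_iff, ← eq_C_of_natDegree_eq_zero hdeg]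
    exact hf P hP
  · rw [← eq_C_of_natDegree_eq_zero hdeg]
    exact hPε

theorem nonempty_polynomial_algEquiv_of_comm (φ : B[X] ≃ₐ[k] k[X][X]) :
    Nonempty (k[X] ≃ₐ[k] B) := by
  have hdX : IsDomain B[X] := φ.toMulEquiv.isDomain k[X][X]
  have hd : IsDomain B := (C_injective (R := B)).isDomain C
  have hufd : UniqueFactorizationMonoid B[X] :=
    φ.symm.toMulEquiv.uniqueFactorizationMonoid inferInstance
  have h1 := trdeg_eq_one_of_algEquiv φ
  let ε : B[X] →ₐ[k] k :=
    ((aeval (0 : k)).comp ((aeval (0 : k[X])).restrictScalars k)).comp φ.toAlgHom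
  obtain ⟨π, hπ, hπε⟩ := exists_prime_mem_ker ε h1
  let η : B →ₐ[k] k := ε.comp CAlgHom
  have hη : π ∈ RingHom.ker η := hπε
  have hdvd : ∀ b : B, η b = 0 → π ∣ b := fun b hb => by
    obtain ⟨g, hg0, hg⟩ := exists_dvd_aeval h1 hπ.ne_zero b
    obtain ⟨r, hr, hXr⟩ := exists_eq_pow_rootMultiplicity_mul_and_not_dvd g hg0 0
    rw [C_0, sub_zero] at hr hXr
    rw [hr, map_mul, map_pow, aeval_X] at hg
    rcases hπ.dvd_or_dvd hg with h2 | h2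
    · exact hπ.dvd_of_dvd_pow h2
    · exact absurd ((RingHom.ker η).mem_of_dvd h2 hη) (aeval_notMem (RingHom.ker_ne_top η) hb
        fun h0 => hXr (X_dvd_iff.2 h0))
  have hlex : ∀ b : B, lexDegree (φ (C b)) = 0 → b = algebraMap k B (η b) := fun b hb => by
    obtain ⟨c, hc⟩ := eq_algebraMap_of_lexDegree_eq_zero hb
    rw [← φ.commutes, EmbeddingLike.apply_eq_iff_eq, Polynomial.algebraMap_apply] at hc
    rw [C_injective hc, AlgHom.commutes]
    rfl
  have hsurj : ∀ d : ℕ, ∀ b : B, lexDegree (φ (C b)) = d → ∃ P : k[X], aeval π P = b := by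
    intro d
    induction d using Nat.strong_induction_on with
    | _ d ih =>
      intro b hb
      obtain ⟨c, hc⟩ := hdvd (b - algebraMap k B (η b)) (by
        rw [map_sub, AlgHom.commutes, sub_eq_zero]; rfl)
      by_cases hc0 : c = 0
      · rw [hc0, mul_zero, sub_eq_zero] at hc
        exact ⟨C (η b), by rw [aeval_C, ← hc]⟩
      · have h2 := congrArg (fun z => lexDegree (φ (C z))) hc
        simp only [map_sub, map_mul] at h2
        rw [← Polynomial.algebraMap_apply, φ.commutes, lexDegree_sub_algebraMap, hb,
          lexDegree_mul] at h2
        · have h3 : lexDegree (φ (C π)) ≠ 0 := fun h0 => hπ.ne_zero (by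
            rw [hlex π h0, RingHom.mem_ker.1 hη, map_zero])
          obtain ⟨P, hP⟩ := ih _ (by omega) c rfl
          refine ⟨C (η b) + X * P, ?_⟩
          rw [map_add, map_mul, aeval_X, aeval_C, hP, ← hc, add_sub_cancel]
        · simpa using hπ.ne_zero
        · simpa using hc0
  have hinj : Function.Injective (aeval π : k[X] →ₐ[k] B) := by
    rw [injective_iff_map_eq_zero]
    intro g hg
    by_contra hg0
    obtain ⟨r, hr, hXr⟩ := exists_eq_pow_rootMultiplicity_mul_and_not_dvd g hg0 0
    rw [C_0, sub_zero] at hr hXr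
    rw [hr, map_mul, map_pow, aeval_X] at hg
    refine aeval_notMem (RingHom.ker_ne_top η) hη (fun h0 => hXr (X_dvd_iff.2 h0)) ?_
    rw [(mul_eq_zero.1 hg).resolve_left (pow_ne_zero _ hπ.ne_zero)]
    exact zero_mem _
  exact ⟨AlgEquiv.ofBijective (aeval π) ⟨hinj, fun b => hsurj _ b rfl⟩⟩

end Cancel

theorem nonempty_polynomial_algEquiv {k : Type u} {B : Type v} [Field k] [Ring B] [Algebra k B]
    (φ : B[X] ≃ₐ[k] k[X][X]) : Nonempty (k[X] ≃ₐ[k] B) := by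
  let _ : CommRing B := { ‹Ring B› with
    mul_comm a b := C_injective (φ.injective (by rw [C_mul, C_mul, map_mul, map_mul, mul_comm])) }
  exact nonempty_polynomial_algEquiv_of_comm φ

end QGWA

theorem QGWA.IsQGWA.nonempty_algEquiv_polynomial {k W : Type u} [Field k] [Ring W] [Algebra k W]
    {q : Fin 0 → k} {h : Fin 0 → k[X]} {x y : Fin 0 → W} {t : W} (H : IsQGWA q h x y t) :
    Nonempty (W ≃ₐ[k] k[X]) := by
  obtain ⟨φ, -, -, ht⟩ := H.lift (A := k[X]) (fun i => i.elim0) (fun i => i.elim0) X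
    ⟨fun i => i.elim0, fun i => i.elim0, fun i => i.elim0, fun i => i.elim0, fun i => i.elim0,
      fun i => i.elim0, fun i => i.elim0⟩
  refine ⟨AlgEquiv.ofAlgHom φ (aeval t) (algHom_ext ?_) (AlgHom.ext fun w => ?_)⟩
  · simp [ht]
  · exact algHom_eq_of_mem_sub (ψ := AlgHom.id k W) (by simp [ht]) (fun i => i.elim0)
      (fun i => i.elim0) (H.mem_sub w)

theorem QGWA.IsQGWA.nonempty_algEquiv_of_injective {k W Z : Type u} [Field k] [CharZero k] [Ring W]
    [Algebra k W] [CommRing Z] [Algebra k Z] {m : ℕ} {q : Fin m → k} {h : Fin m → k[X]}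
    {x y : Fin m → W} {t : W} (H : IsQGWA q h x y t) (f : Z →ₐ[k] W) (hf : Function.Injective f)
    (hcomm : ∀ z w, f z * w = w * f z) (hcen : ∀ w, (∀ v, v * w = w * v) → ∃ z, f z = w)
    (hq : ∀ i, q i ≠ 0) (hh0 : ∀ i, h i ≠ 0) {n : Fin m → ℕ}
    (hn : ∀ i, 0 < n i) (hqn : ∀ i, q i ^ n i = 1) {i₀ : Fin m} (hi₀ : q i₀ ≠ 1)
    {B : Type*} [Ring B] [Algebra k B] (φ : W[X] ≃ₐ[k] B[X]) : Nonempty (W ≃ₐ[k] B) := by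
  let _ : Algebra Z W := RingHom.toAlgebra' f.toRingHom hcomm
  have : IsScalarTower k Z W := IsScalarTower.of_algebraMap_eq fun c => (f.commutes c).symm
  exact H.nonempty_algEquiv (Z := Z) hf hcen hq hh0 hn hqn hi₀ φ

theorem GWA.isQGWA {k : Type u} [Field k] {m : ℕ} {q : Fin m → k} {h : Fin m → k[X]} :
    QGWA.IsQGWA q h (GWA.x (q := q) (h := h)) GWA.y GWA.t where
  xt i := by
    have h1 := RingQuot.mkAlgHom_rel k (GWARel.xt (q := q) (h := h) i)
    rwa [map_mul, map_smul, map_mul] at h1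
  yt i := by
    have h1 := RingQuot.mkAlgHom_rel k (GWARel.yt (q := q) (h := h) i)
    rwa [map_mul, map_smul, map_mul] at h1
  xy i := by
    have h1 := RingQuot.mkAlgHom_rel k (GWARel.xy (q := q) (h := h) i)
    rwa [map_mul, ← aeval_algHom_apply] at h1
  yx i := by
    have h1 := RingQuot.mkAlgHom_rel k (GWARel.yx (q := q) (h := h) i)
    rwa [map_mul, ← aeval_algHom_apply, map_smul] at h1
  xx i j hij := by
    have h1 := RingQuot.mkAlgHom_rel k (GWARel.xx (q := q) (h := h) i j hij)
    rwa [map_mul, map_mul] at h1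
  yy i j hij := by
    have h1 := RingQuot.mkAlgHom_rel k (GWARel.yy (q := q) (h := h) i j hij)
    rwa [map_mul, map_mul] at h1
  xyc i j hij := by
    have h1 := RingQuot.mkAlgHom_rel k (GWARel.xyc (q := q) (h := h) i j hij)
    rwa [map_mul, map_mul] at h1
  gen := by
    rw [eq_top_iff]
    rintro w -
    obtain ⟨f, rfl⟩ := RingQuot.mkAlgHom_surjective k (GWARel k m q h) w
    induction f using FreeAlgebra.induction with
    | grade0 c => rw [AlgHom.commutes]; exact Subalgebra.algebraMap_mem _ c
    | grade1 g =>
      cases g with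
      | x i => exact QGWA.x_mem_sub (Set.mem_univ i)
      | y i => exact QGWA.y_mem_sub (Set.mem_univ i)
      | t => exact QGWA.t_mem_sub
    | mul a b ha hb => rw [map_mul]; exact mul_mem ha hb
    | add a b ha hb => rw [map_add]; exact add_mem ha hb
  lift {A} _ _ x' y' t' H := by
    let ψ : FreeAlgebra k (GWAGen m) →ₐ[k] A :=
      FreeAlgebra.lift k fun g => match g with
        | .x i => x' i
        | .y i => y' i
        | .t => t'
    have hx : ∀ i, ψ (FreeAlgebra.ι k (.x i)) = x' i := fun i => FreeAlgebra.lift_ι_apply _ _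
    have hy : ∀ i, ψ (FreeAlgebra.ι k (.y i)) = y' i := fun i => FreeAlgebra.lift_ι_apply _ _
    have ht : ψ (FreeAlgebra.ι k .t) = t' := FreeAlgebra.lift_ι_apply _ _
    have hψ : ∀ ⦃a b⦄, GWARel k m q h a b → ψ a = ψ b := fun a b hab => by
      cases hab with
      | xt i => rw [map_mul, map_smul, map_mul, hx, ht, H.xt]
      | yt i => rw [map_mul, map_smul, map_mul, hy, ht, H.yt]
      | xy i => rw [map_mul, ← aeval_algHom_apply, hx, hy, ht, H.xy]
      | yx i => rw [map_mul, ← aeval_algHom_apply, map_smul, hx, hy, ht, H.yx]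
      | xx i j hij => rw [map_mul, map_mul, hx, hx, H.xx i j hij]
      | yy i j hij => rw [map_mul, map_mul, hy, hy, H.yy i j hij]
      | xyc i j hij => rw [map_mul, map_mul, hx, hy, H.xyc i j hij]
    refine ⟨RingQuot.liftAlgHom k ⟨ψ, hψ⟩, fun i => ?_, fun i => ?_, ?_⟩
    · exact (RingQuot.liftAlgHom_mkAlgHom_apply k ψ hψ _).trans (hx i)
    · exact (RingQuot.liftAlgHom_mkAlgHom_apply k ψ hψ _).trans (hy i)
    · exact (RingQuot.liftAlgHom_mkAlgHom_apply k ψ hψ _).trans ht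

end

/-- Theorem 6.6(1). Assume `char k = 0`.  Let `W` be a degree `m`
quantum GWA where each `qᵢ` is a root of unity of multiplicative order `nᵢ ≥ 2`, the
orders are pairwise coprime, and each `hᵢ` is nonconstant.  Then `W` is cancellative:
for every `k`-algebra `B`, if `W[s] ≅ B[s]` as `k`-algebras then `W ≅ B`. -/
theorem quantum_GWA_cancellative
    (k : Type*) [Field k] [CharZero k] (m : ℕ) (q : Fin m → k) (h : Fin m → Polynomial k)
    (n : Fin m → ℕ) (hn : ∀ i, 2 ≤ n i) (hq : ∀ i, orderOf (q i) = n i)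
    (hcop : ∀ i j, i ≠ j → Nat.Coprime (n i) (n j)) (hh : ∀ i, 1 ≤ (h i).natDegree)
    (B : Type*) [Ring B] [Algebra k B]
    (hiso : Nonempty (Polynomial (GWA k m q h) ≃ₐ[k] Polynomial B)) :
    Nonempty (GWA k m q h ≃ₐ[k] B) := by
  have H : QGWA.IsQGWA q h (GWA.x (q := q) (h := h)) GWA.y GWA.t := GWA.isQGWA
  have hn0 : ∀ i, n i ≠ 0 := fun i => by have := hn i; omega
  have hqn : ∀ i, q i ^ n i = 1 := fun i => hq i ▸ pow_orderOf_eq_one (q i)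
  have hq0 : ∀ i, q i ≠ 0 := fun i h0 => by simpa [h0, hn0 i] using hqn i
  have hh0 : ∀ i, h i ≠ 0 := fun i => Polynomial.ne_zero_of_natDegree_gt (hh i)
  obtain ⟨φ⟩ := hiso
  rcases Nat.eq_zero_or_pos m with rfl | hm
  · obtain ⟨ψ⟩ := H.nonempty_algEquiv_polynomial
    obtain ⟨χ⟩ := QGWA.nonempty_polynomial_algEquiv (φ.symm.trans (Polynomial.mapAlgEquiv ψ))
    exact ⟨ψ.trans χ⟩
  · refine H.nonempty_algEquiv_of_injective (Z := Subalgebra.center k (GWA k m q h))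
      (Subalgebra.center k (GWA k m q h)).val
      Subtype.val_injective (fun z w => (Subalgebra.mem_center_iff.1 z.2 w).symm)
      (fun w hw => ⟨⟨w, Subalgebra.mem_center_iff.2 hw⟩, rfl⟩) hq0 hh0
      (fun i => Nat.pos_of_ne_zero (hn0 i)) hqn (i₀ := ⟨0, hm⟩) (fun h1 => ?_) φ
    have h2 := hq ⟨0, hm⟩
    have h3 := hn ⟨0, hm⟩
    rw [h1, orderOf_one] at h2
    omega
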